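/- arXiv:2603.17245 — 7 statements merged into one kernel-verified Lean document; each statement's English description precedes it below -/
import Mathlib

section
/- Let n ≥ 1 and d ≥ n+2, and let F be a homogeneous polynomial of degree d in S = ℂ[x_0,…,x_{n+1}] such that the only common zero of the partial derivatives ∂F/∂x_0,…,∂F/∂x_{n+1} in ℂ^{n+2} is the origin. Suppose ℓ ∈ S is a linear form which is a strong Lefschetz element for the Jacobian ring R(F), i.e. for all k, m ∈ ℕ the multiplication map ×ℓ^m : R(F)_k → R(F)_{k+m} has rank equal to min(dim_ℂ R(F)_k, dim_ℂ R(F)_{k+m}). Then the multiplication map ×ℓ^{nd} : R(F)_{d−(n+2)} → R(F)_{(n+1)d−(n+2)} is bijective. -/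
noncomputable section

open MvPolynomial

/-- The Jacobian ideal of `F`, generated by the partial derivatives of `F`. -/
def jacobianIdeal {N : ℕ} (F : MvPolynomial (Fin N) ℂ) : Ideal (MvPolynomial (Fin N) ℂ) :=
  Ideal.span (Set.range fun i => pderiv i F)

/-- The degree-`k` graded piece of the quotient `S ⧸ I`: the image of the homogeneous
polynomials of degree `k` under the quotient map. -/
def gradedPiece {N : ℕ} (I : Ideal (MvPolynomial (Fin N) ℂ)) (k : ℕ) :
    Submodule ℂ (MvPolynomial (Fin N) ℂ ⧸ I) :=
  (homogeneousSubmodule (Fin N) ℂ k).map (Ideal.Quotient.mkₐ ℂ I).toLinearMap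

/-- Multiplication on `S ⧸ I` by the residue class of `g : S`. -/
def mulMap {N : ℕ} (I : Ideal (MvPolynomial (Fin N) ℂ)) (g : MvPolynomial (Fin N) ℂ) :
    (MvPolynomial (Fin N) ℂ ⧸ I) →ₗ[ℂ] (MvPolynomial (Fin N) ℂ ⧸ I) :=
  LinearMap.mulLeft ℂ (Ideal.Quotient.mk I g)

section partA
open CategoryTheory Abelian RingTheory.Sequence

lemma aux_exists_reg {N : ℕ} (f : Fin N → MvPolynomial (Fin N) ℂ)
    (M : Type) [AddCommGroup M] [Module (MvPolynomial (Fin N) ℂ) M]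
    [Module.Finite (MvPolynomial (Fin N) ℂ) M]
    (h : Subsingleton ((MvPolynomial (Fin N) ℂ ⧸ Ideal.span (Set.range f)) →ₗ[MvPolynomial (Fin N) ℂ] M)) :
    ∃ g ∈ Submodule.span ℂ (Set.range f), IsSMulRegular M g := by
  by_contra! hcon
  have hfin := associatedPrimes.finite (MvPolynomial (Fin N) ℂ) M
  have := hfin.to_subtype
  let p : associatedPrimes (MvPolynomial (Fin N) ℂ) M →
      Subspace ℂ (Submodule.span ℂ (Set.range f)) := fun P =>
    (P.1.restrictScalars ℂ).comap (Submodule.span ℂ (Set.range f)).subtype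
  have hcov : ⋃ i, (p i : Set (Submodule.span ℂ (Set.range f))) = Set.univ := by
    rw [Set.eq_univ_iff_forall]
    rintro ⟨g, hg⟩
    have h1 : g ∈ ⋃ p ∈ associatedPrimes (MvPolynomial (Fin N) ℂ) M, (p : Set (MvPolynomial (Fin N) ℂ)) := by
      rw [biUnion_associatedPrimes_eq_compl_regular]
      exact hcon g hg
    simp only [Set.mem_iUnion] at h1 ⊢
    obtain ⟨P, hP, hgP⟩ := h1
    exact ⟨⟨P, hP⟩, hgP⟩
  obtain ⟨⟨P, hP⟩, htop⟩ := Subspace.exists_eq_top_of_iUnion_eq_univ hcov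
  have hJP : Ideal.span (Set.range f) ≤ P := by
    rw [Ideal.span_le]
    intro x hx
    have : (⟨x, Submodule.subset_span hx⟩ : Submodule.span ℂ (Set.range f)) ∈ p ⟨P, hP⟩ := by
      rw [htop]; trivial
    exact this
  obtain ⟨hprime, x, hx⟩ := isAssociatedPrime_iff.mp (AssociatedPrimes.mem_iff.mp hP)
  have hann : ∀ r, r ∈ P ↔ r • x = 0 := by
    intro r
    rw [hx, Submodule.mem_colon_singleton]
    simp
  let φ : (MvPolynomial (Fin N) ℂ ⧸ Ideal.span (Set.range f)) →ₗ[MvPolynomial (Fin N) ℂ] M :=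
    Submodule.liftQ _ (LinearMap.toSpanSingleton _ _ x) (by
      intro r hr
      simpa using (hann r).mp (hJP hr))
  have h0 : φ = 0 := Subsingleton.elim _ _
  have h1 : φ (Submodule.Quotient.mk 1) = 0 := by rw [h0]; rfl
  have h2 : φ (Submodule.Quotient.mk 1) = x :=
    (Submodule.liftQ_apply _ _ _).trans (by simp)
  rw [h2] at h1
  exact hprime.ne_top ((Ideal.eq_top_iff_one _).mpr ((hann 1).mpr (by simp [h1])))

lemma aux_exists_seq {N : ℕ} (f : Fin N → MvPolynomial (Fin N) ℂ) (r : ℕ)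
    (M : ModuleCat.{0} (MvPolynomial (Fin N) ℂ))
    [Module.Finite (MvPolynomial (Fin N) ℂ) M]
    (h : ∀ i < r, Subsingleton
      (Ext (ModuleCat.of (MvPolynomial (Fin N) ℂ)
        (MvPolynomial (Fin N) ℂ ⧸ Ideal.span (Set.range f))) M i)) :
    ∃ gs : List (MvPolynomial (Fin N) ℂ), gs.length = r ∧
      (∀ g ∈ gs, g ∈ Submodule.span ℂ (Set.range f)) ∧ IsWeaklyRegular M gs := by
  induction r generalizing M with
  | zero => exact ⟨[], by simp⟩
  | succ r ih =>
    have h0 := Ext.addEquiv₀.subsingleton_congr.mp (h 0 r.zero_lt_succ)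
    have h0' := ModuleCat.homAddEquiv.subsingleton_congr.mp h0
    obtain ⟨g, hg, hreg⟩ := aux_exists_reg f M h0'
    have hext : ∀ i < r, Subsingleton (Ext (ModuleCat.of (MvPolynomial (Fin N) ℂ)
        (MvPolynomial (Fin N) ℂ ⧸ Ideal.span (Set.range f)))
        (ModuleCat.of _ (QuotSMulTop g M)) i) := by
      intro i hi
      have zero1 := AddCommGrpCat.isZero_of_iff_subsingleton.mpr (h i (by omega))
      have zero2 := AddCommGrpCat.isZero_of_iff_subsingleton.mpr (h (i + 1) (by omega))
      exact AddCommGrpCat.subsingleton_of_isZero <| ShortComplex.Exact.isZero_of_both_zeros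
        ((Ext.covariant_sequence_exact₃' _ hreg.smulShortComplex_shortExact) i (i + 1) rfl)
        (zero1.eq_zero_of_src _) (zero2.eq_zero_of_tgt _)
    obtain ⟨rs, len, mem, reg⟩ := ih (ModuleCat.of _ (QuotSMulTop g M)) hext
    exact ⟨g :: rs, by simp [len], by simpa using ⟨hg, mem⟩,
      (isWeaklyRegular_cons_iff M g rs).mpr ⟨hreg, reg⟩⟩

lemma aux_reg_iff {N : ℕ} (I : Ideal (MvPolynomial (Fin N) ℂ)) (g : MvPolynomial (Fin N) ℂ) :
    IsSMulRegular (MvPolynomial (Fin N) ℂ ⧸ (I • ⊤ : Submodule (MvPolynomial (Fin N) ℂ) (MvPolynomial (Fin N) ℂ))) g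
      ↔ ∀ p, g * p ∈ I → p ∈ I := by
  have hI : (I • ⊤ : Submodule (MvPolynomial (Fin N) ℂ) (MvPolynomial (Fin N) ℂ)) = I := by simp
  rw [hI, isSMulRegular_iff_right_eq_zero_of_smul]
  constructor
  · intro h p hp
    have := h (Submodule.Quotient.mk p) (by
      rw [← Submodule.Quotient.mk_smul, Submodule.Quotient.mk_eq_zero]; exact hp)
    exact (Submodule.Quotient.mk_eq_zero _).mp this
  · intro h x
    obtain ⟨p, rfl⟩ := Submodule.Quotient.mk_surjective _ x
    rw [← Submodule.Quotient.mk_smul, Submodule.Quotient.mk_eq_zero, Submodule.Quotient.mk_eq_zero]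
    exact h p

/-- the list of variables -/
def varList (N : ℕ) : List (MvPolynomial (Fin N) ℂ) := List.ofFn fun i => X i

lemma varList_span (N i : ℕ) (hi : i ≤ N) :
    Ideal.ofList ((varList N).take i) = Ideal.span (X '' {j : Fin N | j.1 < i}) := by
  unfold Ideal.ofList
  congr 1
  ext x
  simp only [varList, Set.mem_ofPred_eq, List.mem_take_iff_getElem, Set.mem_image]
  constructor
  · rintro ⟨j, hj, rfl⟩
    simp at hj
    exact ⟨⟨j, by omega⟩, by simp; omega, by simp⟩
  · rintro ⟨j, hj, rfl⟩
    exact ⟨j.1, by simp; omega, by simp⟩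

lemma varList_regular (N : ℕ) : IsWeaklyRegular (MvPolynomial (Fin N) ℂ) (varList N) := by
  constructor
  intro i hi
  have hi' : i < N := by simpa [varList] using hi
  rw [aux_reg_iff, varList_span N i hi'.le]
  intro p hp
  rw [mem_ideal_span_X_image] at hp ⊢
  intro m hm
  have : (varList N)[i] = X ⟨i, hi'⟩ := by simp [varList]
  rw [this] at hp
  obtain ⟨j, hj, hj2⟩ := hp (Finsupp.single ⟨i, hi'⟩ 1 + m) (by
    rw [mem_support_iff, coeff_X_mul]; exact mem_support_iff.mp hm)
  refine ⟨j, hj, ?_⟩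
  have : (⟨i, hi'⟩ : Fin N) ≠ j := by
    rintro rfl
    simp at hj
  simpa [Finsupp.single_apply, this] using hj2

lemma ofList_varList (N : ℕ) : Ideal.ofList (varList N) = Ideal.span (Set.range X) := by
  have := varList_span N N le_rfl
  rw [List.take_of_length_le (by simp [varList])] at this
  rw [this, ← Set.image_univ]
  congr 2
  ext j; simp

lemma mem_vars_iff {N : ℕ} (p : MvPolynomial (Fin N) ℂ) :
    p ∈ Ideal.span (Set.range (X : Fin N → MvPolynomial (Fin N) ℂ)) ↔ coeff 0 p = 0 := by
  rw [← Set.image_univ, mem_ideal_span_X_image]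
  constructor
  · intro h
    by_contra h0
    obtain ⟨i, -, hi⟩ := h 0 (mem_support_iff.mpr h0)
    simp at hi
  · intro h m hm
    by_contra! hc
    have : m = 0 := by ext i; simpa using hc i (Set.mem_univ _)
    subst this
    exact mem_support_iff.mp hm h

lemma exists_regular_seq {N : ℕ} (f : Fin N → MvPolynomial (Fin N) ℂ)
    (hz : ∀ x : Fin N → ℂ, (∀ i, eval x (f i) = 0) → x = 0) :
    ∃ gs : List (MvPolynomial (Fin N) ℂ), gs.length = N ∧
      (∀ g ∈ gs, g ∈ Submodule.span ℂ (Set.range f)) ∧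
      IsWeaklyRegular (MvPolynomial (Fin N) ℂ) gs := by
  have h1 : (1 : MvPolynomial (Fin N) ℂ) ∉ Ideal.span (Set.range (X : Fin N → MvPolynomial (Fin N) ℂ)) := by
    rw [mem_vars_iff]; simp
  have hne : Ideal.span (Set.range (X : Fin N → MvPolynomial (Fin N) ℂ)) ≠ ⊤ :=
    fun h => h1 (h ▸ trivial)
  have hrad : Ideal.span (Set.range (X : Fin N → MvPolynomial (Fin N) ℂ)) ≤
      (Ideal.span (Set.range f)).radical := by
    rw [← vanishingIdeal_zeroLocus_eq_radical (K := ℂ), Ideal.span_le]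
    rintro _ ⟨i, rfl⟩
    rw [SetLike.mem_coe, mem_vanishingIdeal_iff]
    intro x hx
    rw [mem_zeroLocus_iff] at hx
    have : x = 0 := hz x fun j => by
      have := hx (f j) (Ideal.subset_span ⟨j, rfl⟩)
      simpa [aeval_eq_eval] using this
    simp [this]
  apply aux_exists_seq f N (ModuleCat.of _ (MvPolynomial (Fin N) ℂ))
  have key := ModuleCat.subsingleton_ext_of_exists_isRegular
    (Ideal.span (Set.range (X : Fin N → MvPolynomial (Fin N) ℂ)))
    (ModuleCat.of (MvPolynomial (Fin N) ℂ)
        (MvPolynomial (Fin N) ℂ ⧸ Ideal.span (Set.range f)))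
    (by
      rw [Module.support_eq_zeroLocus, PrimeSpectrum.zeroLocus_subset_zeroLocus_iff]
      change _ ≤ (Module.annihilator _ (MvPolynomial (Fin N) ℂ ⧸ Ideal.span (Set.range f))).radical
      rw [Ideal.annihilator_quotient]
      exact hrad)
    (ModuleCat.of _ (MvPolynomial (Fin N) ℂ))
    (by
      change _ • (⊤ : Submodule (MvPolynomial (Fin N) ℂ) (MvPolynomial (Fin N) ℂ)) < ⊤
      rw [smul_eq_mul, Ideal.mul_top]
      exact hne.lt_top)
    (varList N)
    (by
      intro r hr
      rw [← ofList_varList]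
      exact Ideal.subset_span hr)
    ⟨varList_regular N, by
      change (⊤ : Submodule (MvPolynomial (Fin N) ℂ) (MvPolynomial (Fin N) ℂ)) ≠ _ • (⊤ : Submodule (MvPolynomial (Fin N) ℂ) (MvPolynomial (Fin N) ℂ))
      rw [smul_eq_mul, Ideal.mul_top, ofList_varList]
      exact hne.symm⟩
  have hl : (varList N).length = N := by simp [varList]
  rw [hl] at key
  exact key
end partA
section partB
open RingTheory.Sequence

attribute [local instance] MvPolynomial.gradedAlgebra

lemma hc_mul_add {N : ℕ} {g b : MvPolynomial (Fin N) ℂ} {e : ℕ} (hg : g.IsHomogeneous e) (k : ℕ) :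
    homogeneousComponent (e + k) (g * b) = g * homogeneousComponent k b := by
  rw [← decomposition.decompose'_apply, ← decomposition.decompose'_apply]
  exact DirectSum.coe_decompose_mul_add_of_left_mem (homogeneousSubmodule (Fin N) ℂ) hg

lemma hc_mul_lt {N : ℕ} {g b : MvPolynomial (Fin N) ℂ} {e : ℕ} (hg : g.IsHomogeneous e) (k : ℕ)
    (hk : k < e) :
    homogeneousComponent k (g * b) = 0 := by
  rw [← decomposition.decompose'_apply]
  exact DirectSum.coe_decompose_mul_of_left_mem_of_not_le (homogeneousSubmodule (Fin N) ℂ) hg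
    (by omega)

instance fin_homog (N k : ℕ) : Module.Finite ℂ (homogeneousSubmodule (Fin N) ℂ k) := by
  have : homogeneousSubmodule (Fin N) ℂ k ≤ restrictTotalDegree (Fin N) ℂ k := by
    intro p hp
    rw [mem_restrictTotalDegree]
    exact IsHomogeneous.totalDegree_le hp
  exact Submodule.finiteDimensional_of_le this

instance fin_gradedPiece {N : ℕ} (I : Ideal (MvPolynomial (Fin N) ℂ)) (k : ℕ) :
    Module.Finite ℂ (gradedPiece I k) := by
  unfold gradedPiece; infer_instance

lemma mem_gradedPiece {N : ℕ} {I : Ideal (MvPolynomial (Fin N) ℂ)} {k : ℕ}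
    {x : MvPolynomial (Fin N) ℂ ⧸ I} :
    x ∈ gradedPiece I k ↔ ∃ p : MvPolynomial (Fin N) ℂ, p.IsHomogeneous k ∧
      Ideal.Quotient.mk I p = x := Iff.rfl

lemma finrank_map_add_ker {V W : Type*} [AddCommGroup V] [Module ℂ V] [AddCommGroup W]
    [Module ℂ W] (φ : V →ₗ[ℂ] W) (A : Submodule ℂ V) [Module.Finite ℂ A] :
    Module.finrank ℂ (A.map φ) + Module.finrank ℂ (A ⊓ LinearMap.ker φ : Submodule ℂ V)
      = Module.finrank ℂ A := by
  have h := LinearMap.finrank_range_add_finrank_ker (φ.domRestrict A)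
  have h1 : LinearMap.range (φ.domRestrict A) = A.map φ := by
    rw [LinearMap.range_domRestrict]
  have h2 : (LinearMap.ker (φ.domRestrict A)).map A.subtype = A ⊓ LinearMap.ker φ := by
    ext x
    simp only [Submodule.mem_map, LinearMap.mem_ker, Submodule.mem_inf]
    constructor
    · rintro ⟨y, hy, rfl⟩; exact ⟨y.2, hy⟩
    · rintro ⟨hx, hy⟩; exact ⟨⟨x, hx⟩, hy, rfl⟩
  rw [← h, h1, ← h2]
  congr 1
  exact (LinearEquiv.finrank_eq (Submodule.equivMapOfInjective _ A.injective_subtype _)).symm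

/-- quotient to bigger ideal -/
def facMap {N : ℕ} {I J : Ideal (MvPolynomial (Fin N) ℂ)} (h : I ≤ J) :
    (MvPolynomial (Fin N) ℂ ⧸ I) →ₗ[ℂ] (MvPolynomial (Fin N) ℂ ⧸ J) :=
  (Ideal.Quotient.factorₐ ℂ h).toLinearMap

lemma facMap_mk {N : ℕ} {I J : Ideal (MvPolynomial (Fin N) ℂ)} (h : I ≤ J)
    (p : MvPolynomial (Fin N) ℂ) :
    facMap h (Ideal.Quotient.mk I p) = Ideal.Quotient.mk J p := rfl

lemma facMap_map {N : ℕ} {I J : Ideal (MvPolynomial (Fin N) ℂ)} (h : I ≤ J) (k : ℕ) :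
    (gradedPiece I k).map (facMap h) = gradedPiece J k := by
  ext x
  simp only [Submodule.mem_map, mem_gradedPiece]
  constructor
  · rintro ⟨_, ⟨p, hp, rfl⟩, rfl⟩; exact ⟨p, hp, rfl⟩
  · rintro ⟨p, hp, rfl⟩; exact ⟨_, ⟨p, hp, rfl⟩, rfl⟩

/-- homogeneous ideal -/
def Hom' {N : ℕ} (I : Ideal (MvPolynomial (Fin N) ℂ)) : Prop :=
  ∀ p ∈ I, ∀ k, homogeneousComponent k p ∈ I

lemma Hom'.sup {N : ℕ} {I : Ideal (MvPolynomial (Fin N) ℂ)} (hI : Hom' I)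
    {g : MvPolynomial (Fin N) ℂ} {e : ℕ} (hg : g.IsHomogeneous e) :
    Hom' (I ⊔ Ideal.span {g}) := by
  intro p hp k
  obtain ⟨a, ha, c, hc, rfl⟩ := Submodule.mem_sup.mp hp
  obtain ⟨b, rfl⟩ := Ideal.mem_span_singleton.mp hc
  rw [map_add]
  refine Submodule.add_mem_sup (hI a ha k) ?_
  by_cases hk : k < e
  · rw [hc_mul_lt hg k hk]; exact zero_mem _
  · obtain ⟨j, rfl⟩ := Nat.exists_eq_add_of_le (not_lt.mp hk)
    rw [hc_mul_add hg]
    exact Ideal.mem_span_singleton.mpr (Dvd.intro _ rfl)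

/-- Hilbert function -/
def hilb {N : ℕ} (I : Ideal (MvPolynomial (Fin N) ℂ)) (k : ℕ) : ℕ :=
  Module.finrank ℂ (gradedPiece I k)

lemma hilb_lt {N : ℕ} {I : Ideal (MvPolynomial (Fin N) ℂ)} (hI : Hom' I)
    {g : MvPolynomial (Fin N) ℂ} {e : ℕ} (hg : g.IsHomogeneous e) (k : ℕ) (hk : k < e) :
    hilb (I ⊔ Ideal.span {g}) k = hilb I k := by
  have h := finrank_map_add_ker (facMap (le_sup_left : I ≤ I ⊔ Ideal.span {g})) (gradedPiece I k)
  rw [facMap_map] at h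
  have h0 : gradedPiece I k ⊓ LinearMap.ker (facMap (le_sup_left : I ≤ I ⊔ Ideal.span {g})) = ⊥ := by
    rw [eq_bot_iff]
    rintro x ⟨⟨p, hp, rfl⟩, hx⟩
    have hx' : p ∈ I ⊔ Ideal.span {g} := Ideal.Quotient.eq_zero_iff_mem.mp hx
    obtain ⟨a, ha, c, hc, rfl⟩ := Submodule.mem_sup.mp hx'
    obtain ⟨b, rfl⟩ := Ideal.mem_span_singleton.mp hc
    have h1 := homogeneousComponent_eq_self hp
    rw [map_add, hc_mul_lt hg k hk, add_zero] at h1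
    exact Ideal.Quotient.eq_zero_iff_mem.mpr (h1 ▸ hI a ha k)
  rw [h0] at h
  simpa [hilb] using h

lemma hilb_add {N : ℕ} {I : Ideal (MvPolynomial (Fin N) ℂ)} (hI : Hom' I)
    {g : MvPolynomial (Fin N) ℂ} {e : ℕ} (hg : g.IsHomogeneous e)
    (hreg : ∀ p, g * p ∈ I → p ∈ I) (k : ℕ) :
    hilb (I ⊔ Ideal.span {g}) (e + k) + hilb I k = hilb I (e + k) := by
  have h := finrank_map_add_ker (facMap (le_sup_left : I ≤ I ⊔ Ideal.span {g})) (gradedPiece I (e + k))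
  rw [facMap_map] at h
  have h0 : gradedPiece I (e + k) ⊓ LinearMap.ker (facMap (le_sup_left : I ≤ I ⊔ Ideal.span {g}))
      = (gradedPiece I k).map (mulMap I g) := by
    apply le_antisymm
    · rintro x ⟨⟨p, hp, rfl⟩, hx⟩
      have hx' : p ∈ I ⊔ Ideal.span {g} := Ideal.Quotient.eq_zero_iff_mem.mp hx
      obtain ⟨a, ha, c, hc, rfl⟩ := Submodule.mem_sup.mp hx'
      obtain ⟨b, rfl⟩ := Ideal.mem_span_singleton.mp hc
      have h1 := homogeneousComponent_eq_self hp
      rw [map_add, hc_mul_add hg k] at h1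
      refine ⟨Ideal.Quotient.mk I (homogeneousComponent k b),
        ⟨_, homogeneousComponent_isHomogeneous k b, rfl⟩, ?_⟩
      change Ideal.Quotient.mk I g * Ideal.Quotient.mk I _ = Ideal.Quotient.mk I (a + g * b)
      rw [← map_mul, ← h1, Ideal.Quotient.eq]
      have : g * homogeneousComponent k b - (homogeneousComponent (e + k) a
        + g * homogeneousComponent k b) = - homogeneousComponent (e + k) a := by ring
      rw [this]
      exact neg_mem (hI a ha _)
    · rintro _ ⟨_, ⟨p, hp, rfl⟩, rfl⟩
      refine ⟨⟨g * p, hg.mul hp, map_mul (Ideal.Quotient.mk I) _ _⟩, ?_⟩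
      change Ideal.Quotient.mk (I ⊔ Ideal.span {g}) (g * p) = 0
      rw [Ideal.Quotient.eq_zero_iff_mem]
      exact Ideal.mem_sup_right (Ideal.mem_span_singleton.mpr (Dvd.intro _ rfl))
  have hinj : Function.Injective (mulMap I g) := by
    rw [injective_iff_map_eq_zero]
    intro x hx
    obtain ⟨p, rfl⟩ := Ideal.Quotient.mk_surjective x
    change Ideal.Quotient.mk I g * Ideal.Quotient.mk I p = 0 at hx
    rw [← map_mul, Ideal.Quotient.eq_zero_iff_mem] at hx
    exact Ideal.Quotient.eq_zero_iff_mem.mpr (hreg p hx)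
  rw [h0, ← LinearEquiv.finrank_eq (Submodule.equivMapOfInjective _ hinj _)] at h
  exact h

/-- Hilbert series -/
def hilbS {N : ℕ} (I : Ideal (MvPolynomial (Fin N) ℂ)) : PowerSeries ℤ :=
  PowerSeries.mk fun k => (hilb I k : ℤ)

lemma hilbS_step {N : ℕ} {I : Ideal (MvPolynomial (Fin N) ℂ)} (hI : Hom' I)
    {g : MvPolynomial (Fin N) ℂ} {e : ℕ} (hg : g.IsHomogeneous e)
    (hreg : ∀ p, g * p ∈ I → p ∈ I) :
    hilbS (I ⊔ Ideal.span {g}) = (1 - PowerSeries.X ^ e) * hilbS I := by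
  ext k
  rw [sub_mul, one_mul, map_sub, PowerSeries.coeff_X_pow_mul']
  split_ifs with hk
  · obtain ⟨j, rfl⟩ := Nat.exists_eq_add_of_le hk
    have := hilb_add hI hg hreg j
    simp only [hilbS, PowerSeries.coeff_mk, Nat.add_sub_cancel_left]
    rw [← this]; push_cast; ring
  · simp [hilbS, hilb_lt hI hg k (by omega)]

lemma hilbS_list {N : ℕ} (e : ℕ) (gs : List (MvPolynomial (Fin N) ℂ))
    (hg : ∀ g ∈ gs, g.IsHomogeneous e) (hreg : IsWeaklyRegular (MvPolynomial (Fin N) ℂ) gs) :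
    Hom' (Ideal.ofList gs) ∧
    hilbS (Ideal.ofList gs) = (1 - PowerSeries.X ^ e) ^ gs.length *
      hilbS (⊥ : Ideal (MvPolynomial (Fin N) ℂ)) := by
  induction gs using List.reverseRecOn with
  | nil =>
    simp only [Ideal.ofList_nil, List.length_nil, pow_zero, one_mul, and_true]
    intro p hp k
    rw [Ideal.mem_bot] at hp
    simp [hp]
  | append_singleton gs g ih =>
    rw [isWeaklyRegular_append_iff, isWeaklyRegular_singleton_iff, aux_reg_iff] at hreg
    obtain ⟨hH, hS⟩ := ih (fun x hx => hg x (by simp [hx])) hreg.1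
    have hge : g.IsHomogeneous e := hg g (by simp)
    rw [Ideal.ofList_append, Ideal.ofList_singleton]
    refine ⟨hH.sup hge, ?_⟩
    rw [hilbS_step hH hge hreg.2, hS, List.length_append, List.length_singleton, pow_succ]
    ring

lemma hilbS_vars (N : ℕ) :
    hilbS (Ideal.span (Set.range (X : Fin N → MvPolynomial (Fin N) ℂ))) = 1 := by
  ext k
  simp only [hilbS, PowerSeries.coeff_mk, PowerSeries.coeff_one]
  set I := Ideal.span (Set.range (X : Fin N → MvPolynomial (Fin N) ℂ)) with hIdef
  split_ifs with hk
  · subst hk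
    have h1 : gradedPiece I 0 = Submodule.span ℂ {1} := by
      ext x
      rw [mem_gradedPiece, Submodule.mem_span_singleton]
      constructor
      · rintro ⟨p, hp, rfl⟩
        refine ⟨coeff 0 p, ?_⟩
        have : p = C (coeff 0 p) := by
          rw [← homogeneousComponent_zero, homogeneousComponent_eq_self hp]
        conv_rhs => rw [this]
        change Ideal.Quotient.mk I (coeff 0 p • 1) = _
        rw [smul_eq_C_mul, mul_one]
      · rintro ⟨a, rfl⟩
        refine ⟨C a, isHomogeneous_C _ _, ?_⟩
        change _ = Ideal.Quotient.mk I (a • 1)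
        rw [smul_eq_C_mul, mul_one]
    have h2 : (1 : MvPolynomial (Fin N) ℂ ⧸ I) ≠ 0 := by
      intro h
      have := Ideal.Quotient.eq_zero_iff_mem.mp ((map_one (Ideal.Quotient.mk I)).trans h)
      rw [hIdef, mem_vars_iff] at this
      simp at this
    rw [hilb, h1, finrank_span_singleton h2]
    rfl
  · have h1 : gradedPiece I k = ⊥ := by
      rw [eq_bot_iff]
      rintro _ ⟨p, hp, rfl⟩
      refine Ideal.Quotient.eq_zero_iff_mem.mpr ?_
      rw [hIdef, mem_vars_iff]
      exact IsHomogeneous.coeff_eq_zero hp (by simpa using Ne.symm hk)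
    rw [hilb, h1]
    simp

lemma hilbS_ci {N : ℕ} (e : ℕ) (gs : List (MvPolynomial (Fin N) ℂ)) (hlen : gs.length = N)
    (hg : ∀ g ∈ gs, g.IsHomogeneous e) (hreg : IsWeaklyRegular (MvPolynomial (Fin N) ℂ) gs) :
    hilbS (Ideal.ofList gs) =
      (((∑ i ∈ Finset.range e, Polynomial.X ^ i) ^ N : Polynomial ℤ) : PowerSeries ℤ) := by
  have h1 := (hilbS_list e gs hg hreg).2
  have h2 := (hilbS_list 1 (varList N) (by
    intro g hg
    simp only [varList, List.mem_ofFn] at hg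
    obtain ⟨i, rfl⟩ := hg
    exact isHomogeneous_X _ _) (varList_regular N)).2
  rw [ofList_varList, hilbS_vars] at h2
  have hl : (varList N).length = N := by simp [varList]
  rw [hl, pow_one] at h2
  rw [hlen] at h1
  have hne : ((1 - PowerSeries.X : PowerSeries ℤ)) ^ N ≠ 0 := by
    intro h; rw [h, zero_mul] at h2; exact one_ne_zero h2
  apply mul_left_cancel₀ hne
  have h3 : (1 - PowerSeries.X : PowerSeries ℤ) * (∑ i ∈ Finset.range e, PowerSeries.X ^ i)
      = 1 - PowerSeries.X ^ e := mul_neg_geom_sum _ _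
  have h4 : (((∑ i ∈ Finset.range e, Polynomial.X ^ i) ^ N : Polynomial ℤ) : PowerSeries ℤ)
      = (∑ i ∈ Finset.range e, PowerSeries.X ^ i) ^ N := by
    rw [Polynomial.coe_pow]
    congr 1
    rw [← Polynomial.coeToPowerSeries.ringHom_apply, map_sum]
    simp
  rw [h4, ← mul_pow, h3, h1, mul_left_comm, ← h2, mul_one]

lemma geom_natDegree (e : ℕ) :
    (∑ i ∈ Finset.range e, Polynomial.X ^ i : Polynomial ℤ).natDegree ≤ e - 1 := by
  apply Polynomial.natDegree_sum_le_of_forall_le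
  intro i hi
  rw [Polynomial.natDegree_X_pow]
  have := Finset.mem_range.mp hi
  omega

lemma geom_reflect (e N : ℕ) :
    Polynomial.reflect (N * (e - 1)) ((∑ i ∈ Finset.range e, Polynomial.X ^ i : Polynomial ℤ) ^ N)
      = (∑ i ∈ Finset.range e, Polynomial.X ^ i) ^ N := by
  induction N with
  | zero => simp
  | succ N ih =>
    rw [pow_succ, Nat.succ_mul, Polynomial.reflect_mul _ _ _ (geom_natDegree e), ih]
    · congr 1
      ext k
      simp only [Polynomial.coeff_reflect, Polynomial.finsetSum_coeff, Polynomial.coeff_X_pow,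
        Finset.sum_ite_eq, Finset.mem_range]
      have : Polynomial.revAt (e - 1) k < e ↔ k < e := by
        rcases le_or_gt k (e - 1) with h | h
        · rw [Polynomial.revAt_le h]; omega
        · rw [Polynomial.revAt_eq_self_of_lt h]
      simp [this]
    · exact Polynomial.natDegree_pow_le_of_le N (geom_natDegree e)

lemma hilb_symm {N : ℕ} (e : ℕ) (gs : List (MvPolynomial (Fin N) ℂ)) (hlen : gs.length = N)
    (hg : ∀ g ∈ gs, g.IsHomogeneous e) (hreg : IsWeaklyRegular (MvPolynomial (Fin N) ℂ) gs)
    (i j : ℕ) (hij : i + j = N * (e - 1)) :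
    hilb (Ideal.ofList gs) i = hilb (Ideal.ofList gs) j := by
  have h := hilbS_ci e gs hlen hg hreg
  have hc : ∀ k, (hilb (Ideal.ofList gs) k : ℤ) =
      ((∑ i ∈ Finset.range e, Polynomial.X ^ i : Polynomial ℤ) ^ N).coeff k := by
    intro k
    rw [← Polynomial.coeff_coe, ← h]
    simp [hilbS]
  have : (hilb (Ideal.ofList gs) i : ℤ) = hilb (Ideal.ofList gs) j := by
    rw [hc, hc, ← geom_reflect, Polynomial.coeff_reflect, Polynomial.revAt_le (by omega),
      geom_reflect]
    congr 1
    omega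
  exact_mod_cast this

lemma ofList_eq {N e : ℕ} (he : 1 ≤ e) (f : Fin N → MvPolynomial (Fin N) ℂ)
    (hf : ∀ i, (f i).IsHomogeneous e)
    (gs : List (MvPolynomial (Fin N) ℂ)) (hlen : gs.length = N)
    (hg : ∀ g ∈ gs, g ∈ Submodule.span ℂ (Set.range f))
    (hreg : IsWeaklyRegular (MvPolynomial (Fin N) ℂ) gs) :
    (∀ g ∈ gs, g.IsHomogeneous e) ∧ Ideal.ofList gs = Ideal.span (Set.range f) := by
  have hle : Submodule.span ℂ (Set.range f) ≤ homogeneousSubmodule (Fin N) ℂ e := by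
    rw [Submodule.span_le]; rintro _ ⟨i, rfl⟩; exact hf i
  have hfin : Module.Finite ℂ (Submodule.span ℂ (Set.range f)) :=
    Module.Finite.span_of_finite ℂ (Set.finite_range f)
  refine ⟨fun g h => hle (hg g h), ?_⟩
  have key : ∀ gs : List (MvPolynomial (Fin N) ℂ),
      (∀ g ∈ gs, g ∈ Submodule.span ℂ (Set.range f)) →
      IsWeaklyRegular (MvPolynomial (Fin N) ℂ) gs →
      gs.length ≤ Module.finrank ℂ (Submodule.span ℂ {g | g ∈ gs}) := by
    intro gs
    induction gs using List.reverseRecOn with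
    | nil => simp
    | append_singleton gs g ih =>
      intro hg hreg
      rw [isWeaklyRegular_append_iff, isWeaklyRegular_singleton_iff, aux_reg_iff] at hreg
      have h1 := ih (fun x hx => hg x (by simp [hx])) hreg.1
      have hlt : Submodule.span ℂ {x | x ∈ gs} < Submodule.span ℂ {x | x ∈ gs ++ [g]} := by
        refine lt_of_le_of_ne (Submodule.span_mono fun x hx => by
          simp only [Set.mem_ofPred_eq] at hx ⊢; simp [hx]) fun heq => ?_
        have hgm : g ∈ Submodule.span ℂ {x | x ∈ gs} := by
          rw [heq]; exact Submodule.subset_span (by simp)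
        have hle2 : Submodule.span ℂ {x | x ∈ gs} ≤ (Ideal.ofList gs).restrictScalars ℂ := by
          rw [Submodule.span_le]; intro x hx; exact Ideal.subset_span hx
        have h1I := hreg.2 1 (by rw [mul_one]; exact hle2 hgm)
        have hle3 : Ideal.ofList gs ≤ Ideal.span (Set.range X) := by
          refine Ideal.span_le.mpr fun x hx => ?_
          rw [SetLike.mem_coe, mem_vars_iff]
          have hx' : x.IsHomogeneous e := hle (hg x (List.mem_append_left _ hx))
          exact hx'.coeff_eq_zero (by simp; omega)
        have := hle3 h1I
        rw [mem_vars_iff] at this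
        simp at this
      have hfin2 : Module.Finite ℂ (Submodule.span ℂ {x | x ∈ gs ++ [g]}) :=
        Module.Finite.span_of_finite ℂ (List.finite_toSet _)
      have := Submodule.finrank_lt_finrank_of_lt hlt
      rw [List.length_append, List.length_singleton]
      omega
  have h1 := key gs hg hreg
  have h2 : Module.finrank ℂ (Submodule.span ℂ (Set.range f)) ≤ N := by
    simpa [Set.finrank] using finrank_range_le_card (R := ℂ) f
  have h3 : Submodule.span ℂ {g | g ∈ gs} = Submodule.span ℂ (Set.range f) :=
    Submodule.eq_of_le_of_finrank_le (Submodule.span_le.mpr hg) (by omega)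
  apply le_antisymm
  · refine Ideal.span_le.mpr fun x hx => ?_
    exact Submodule.span_le_restrictScalars ℂ _ (Set.range f) (hg x hx)
  · refine Ideal.span_le.mpr ?_
    rintro _ ⟨i, rfl⟩
    have : f i ∈ Submodule.span ℂ {g | g ∈ gs} := h3 ▸ Submodule.subset_span ⟨i, rfl⟩
    exact Submodule.span_le_restrictScalars ℂ (MvPolynomial (Fin N) ℂ) _ this
end partB

/-- If `ℓ` is a strong Lefschetz element for the Jacobian ring `R(F)` of a smooth hypersurface
of degree `d ≥ n+2`, then `×ℓ^{nd} : R(F)_{d-(n+2)} → R(F)_{(n+1)d-(n+2)}` is bijective. -/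
theorem strong_lefschetz_gives_bijective_yukawa_map
    (n d : ℕ) (hn : 1 ≤ n) (hd : n + 2 ≤ d)
    (F : MvPolynomial (Fin (n + 2)) ℂ) (hF : F.IsHomogeneous d)
    (hsmooth : ∀ x : Fin (n + 2) → ℂ, (∀ i, eval x (pderiv i F) = 0) → x = 0)
    (ℓ : MvPolynomial (Fin (n + 2)) ℂ) (hℓ : ℓ.IsHomogeneous 1)
    (hSL : ∀ k m : ℕ,
      Module.finrank ℂ
          ((gradedPiece (jacobianIdeal F) k).map (mulMap (jacobianIdeal F) (ℓ ^ m)))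
        = min (Module.finrank ℂ (gradedPiece (jacobianIdeal F) k))
            (Module.finrank ℂ (gradedPiece (jacobianIdeal F) (k + m)))) :
    (∀ x ∈ gradedPiece (jacobianIdeal F) (d - (n + 2)),
        mulMap (jacobianIdeal F) (ℓ ^ (n * d)) x = 0 → x = 0) ∧
    (gradedPiece (jacobianIdeal F) (d - (n + 2))).map (mulMap (jacobianIdeal F) (ℓ ^ (n * d)))
      = gradedPiece (jacobianIdeal F) ((n + 1) * d - (n + 2)) := by
  have he : 1 ≤ d - 1 := by omega
  have hf : ∀ i, (pderiv i F).IsHomogeneous (d - 1) := fun i => hF.pderiv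
  obtain ⟨gs, hlen, hmem, hreg⟩ := exists_regular_seq (fun i => pderiv i F) hsmooth
  obtain ⟨hgs, hJ⟩ := ofList_eq he (fun i => pderiv i F) hf gs hlen hmem hreg
  have hJ' : Ideal.ofList gs = jacobianIdeal F := hJ
  obtain ⟨c, rfl⟩ := Nat.exists_eq_add_of_le hd
  have e1 : n + 2 + c - (n + 2) = c := by omega
  have e2 : (n + 1) * (n + 2 + c) - (n + 2) = c + n * (n + 2 + c) := by
    have : (n + 1) * (n + 2 + c) = c + n * (n + 2 + c) + (n + 2) := by ring
    omega
  have hsym := hilb_symm (n + 2 + c - 1) gs hlen hgs hreg c (c + n * (n + 2 + c)) (by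
    have : n + 2 + c - 1 - 1 = n + c := by omega
    rw [this]; ring)
  rw [hJ'] at hsym
  unfold hilb at hsym
  rw [e1, e2]
  have hr := hSL c (n * (n + 2 + c))
  rw [← hsym, min_self] at hr
  have hk := finrank_map_add_ker (mulMap (jacobianIdeal F) (ℓ ^ (n * (n + 2 + c))))
    (gradedPiece (jacobianIdeal F) c)
  constructor
  · intro x hx hx0
    have h0 : Module.finrank ℂ (gradedPiece (jacobianIdeal F) c ⊓
      LinearMap.ker (mulMap (jacobianIdeal F) (ℓ ^ (n * (n + 2 + c)))) : Submodule ℂ _) = 0 := by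
      omega
    have hfin : Module.Finite ℂ (gradedPiece (jacobianIdeal F) c ⊓
      LinearMap.ker (mulMap (jacobianIdeal F) (ℓ ^ (n * (n + 2 + c)))) : Submodule ℂ _) :=
      Submodule.finiteDimensional_of_le (inf_le_left : _ ≤ gradedPiece (jacobianIdeal F) c)
    have hb := Submodule.finrank_eq_zero.mp h0
    have : x ∈ gradedPiece (jacobianIdeal F) c ⊓
      LinearMap.ker (mulMap (jacobianIdeal F) (ℓ ^ (n * (n + 2 + c)))) := ⟨hx, hx0⟩
    rw [hb] at this
    exact this
  · refine Submodule.eq_of_le_of_finrank_eq ?_ (hr.trans hsym)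
    rintro _ ⟨_, ⟨p, hp, rfl⟩, rfl⟩
    refine ⟨ℓ ^ (n * (n + 2 + c)) * p, ?_, map_mul (Ideal.Quotient.mk (jacobianIdeal F)) _ _⟩
    have h1 := (hℓ.pow (n * (n + 2 + c))).mul hp
    rw [one_mul, add_comm (n * (n + 2 + c)) c] at h1
    exact h1
end
end

section
/- Let n ≥ 1 and d ≥ n+2, and let F = x_0^d + x_1^d + ⋯ + x_{n+1}^d ∈ ℂ[x_0,…,x_{n+1}] be the Fermat polynomial, with Jacobian ring R(F) = S ⧸ (∂F/∂x_0,…,∂F/∂x_{n+1}). Let ℓ = x_0 + x_1 + ⋯ + x_{n+1}. Then the multiplication map ×ℓ^{nd} : R(F)_{d−(n+2)} → R(F)_{(n+1)d−(n+2)} is bijective. -/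
noncomputable section

open MvPolynomial

theorem sl2_comm {W : Type*} [AddCommGroup W] [Module ℂ W] (V : ℤ → Submodule ℂ W)
    (E F : W →ₗ[ℂ] W) (M : ℤ)
    (hE : ∀ k, ∀ x ∈ V k, E x ∈ V (k + 1))
    (hEF : ∀ k, ∀ x ∈ V k, F (E x) = E (F x) + ((M - 2 * k : ℤ) : ℂ) • x)
    (k : ℤ) (x : W) (hx : x ∈ V k) (j : ℕ) :
    (E ^ j) x ∈ V (k + j) ∧
    F ((E ^ (j+1)) x) = (E ^ (j+1)) (F x) + (((j + 1) * (M - 2 * k - j) : ℤ) : ℂ) • (E ^ j) x := by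
  induction j with
  | zero =>
    refine ⟨by simpa using hx, ?_⟩
    simpa using hEF k x hx
  | succ j ih =>
    obtain ⟨h1, h2⟩ := ih
    have h3 : (E ^ (j+1)) x ∈ V (k + (j + 1 : ℕ)) := by
      rw [pow_succ', Module.End.mul_apply]
      have := hE _ _ h1
      convert this using 2
      push_cast; ring
    refine ⟨h3, ?_⟩
    rw [pow_succ' E (j+1), Module.End.mul_apply, hEF _ _ h3, h2, map_add, map_smul,
      Module.End.mul_apply, ← Module.End.mul_apply E (E ^ j), ← pow_succ', add_assoc, ← add_smul]
    congr 2
    push_cast; ring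

theorem sl2_inj {W : Type*} [AddCommGroup W] [Module ℂ W] (V : ℤ → Submodule ℂ W)
    (E F : W →ₗ[ℂ] W) (M : ℤ)
    (hE : ∀ k, ∀ x ∈ V k, E x ∈ V (k + 1))
    (hF : ∀ k, ∀ x ∈ V k, F x ∈ V (k - 1))
    (hEF : ∀ k, ∀ x ∈ V k, F (E x) = E (F x) + ((M - 2 * k : ℤ) : ℂ) • x)
    (h0 : ∀ x ∈ V (-1), x = 0) (a : ℕ) :
    ∀ w : ℕ, M = 2 * a + w → ∀ x ∈ V a, (E ^ w) x = 0 → x = 0 := by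
  have key : ∀ (k : ℤ) (w : ℕ), M = 2 * k + w → ∀ x ∈ V k, F x = 0 →
      ∀ j : ℕ, j ≤ w → (E ^ j) x = 0 → x = 0 := by
    intro k w hM x hx hFx j
    induction j with
    | zero => intro _ h; simpa using h
    | succ j ih =>
      intro hj h
      have h2 := (sl2_comm V E F M hE hEF k x hx j).2
      rw [h, hFx, map_zero, map_zero, zero_add] at h2
      refine ih (by omega) ?_
      rcases smul_eq_zero.1 h2.symm with h3 | h3
      · exfalso
        have h4 : ((j + 1 : ℤ) * (M - 2 * k - j)) = 0 := by exact_mod_cast h3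
        rcases mul_eq_zero.1 h4 with h5 | h5 <;> omega
      · exact h3
  induction a with
  | zero =>
    intro w hM x hx h
    refine key _ w hM x hx ?_ w le_rfl h
    exact h0 _ (by simpa using hF _ _ hx)
  | succ a ih =>
    intro w hM x hx h
    refine key _ w hM x hx ?_ w le_rfl h
    refine ih (w + 2) (by push_cast at hM ⊢; omega) _ (by simpa using hF _ _ hx) ?_
    have h1 : (E ^ (w+1)) x = 0 := by rw [pow_succ', Module.End.mul_apply, h, map_zero]
    have h2 := (sl2_comm V E F M hE hEF _ x hx w).2
    have h3 : M - 2 * ((a + 1 : ℕ) : ℤ) - w = 0 := by omega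
    rw [h1, h3, h, map_zero, smul_zero, add_zero] at h2
    rw [pow_succ', Module.End.mul_apply, ← h2, map_zero]

theorem sl2_map_mem {W : Type*} [AddCommGroup W] [Module ℂ W] (V : ℤ → Submodule ℂ W)
    (E : W →ₗ[ℂ] W) (hE : ∀ k, ∀ x ∈ V k, E x ∈ V (k + 1)) (k : ℤ) (j : ℕ) :
    ∀ x ∈ V k, (E ^ j) x ∈ V (k + j) := by
  intro x hx
  induction j with
  | zero => simpa using hx
  | succ j ih =>
    rw [pow_succ', Module.End.mul_apply]
    have := hE _ _ ih
    convert this using 2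
    push_cast; ring

theorem sl2_bij {W : Type*} [AddCommGroup W] [Module ℂ W] (V : ℤ → Submodule ℂ W)
    (E F : W →ₗ[ℂ] W) (M : ℤ)
    (hfin : ∀ k, FiniteDimensional ℂ (V k))
    (hE : ∀ k, ∀ x ∈ V k, E x ∈ V (k + 1))
    (hF : ∀ k, ∀ x ∈ V k, F x ∈ V (k - 1))
    (hEF : ∀ k, ∀ x ∈ V k, F (E x) = E (F x) + ((M - 2 * k : ℤ) : ℂ) • x)
    (h0 : ∀ x ∈ V (-1), x = 0) (h1 : ∀ x ∈ V (M + 1), x = 0) (a w : ℕ) (hM : M = 2 * a + w) :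
    (∀ x ∈ V a, (E ^ w) x = 0 → x = 0) ∧ (V a).map (E ^ w) = V (a + w) := by
  have i1 := sl2_inj V E F M hE hF hEF h0 a w hM
  have hF' : ∀ k, ∀ x ∈ V (M - k), F x ∈ V (M - (k + 1)) := fun k x hx => by
    have := hF _ _ hx
    rwa [sub_sub] at this
  have i2 := sl2_inj (fun k => V (M - k)) F E M hF'
    (fun k x hx => by
      have := hE _ _ hx
      convert this using 2; ring)
    (fun k x hx => by
      have := hEF _ _ hx
      rw [this, add_assoc, ← add_smul, ← Int.cast_add]
      have h : M - 2 * (M - k) + (M - 2 * k) = 0 := by ring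
      rw [h]; simp)
    (fun x hx => h1 x (by simpa using hx)) a w hM
  have m1 := sl2_map_mem V E hE a w
  have m2 := sl2_map_mem (fun k => V (M - k)) F hF' a w
  have e1 : M - a = a + w := by omega
  have e2 : M - (a + w) = a := by omega
  simp only [e1, e2] at i2 m2
  refine ⟨i1, ?_⟩
  let f : V a →ₗ[ℂ] V (a + w) := (E ^ w).restrict m1
  let g : V (a + w) →ₗ[ℂ] V a := (F ^ w).restrict m2
  have hf : Function.Injective f := by
    rw [← LinearMap.ker_eq_bot, LinearMap.ker_eq_bot']
    intro x hx
    exact Subtype.ext (i1 x x.2 (congrArg Subtype.val hx))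
  have hg : Function.Injective g := by
    rw [← LinearMap.ker_eq_bot, LinearMap.ker_eq_bot']
    intro x hx
    exact Subtype.ext (i2 x x.2 (congrArg Subtype.val hx))
  have hd := le_antisymm (LinearMap.finrank_le_finrank_of_injective hf)
    (LinearMap.finrank_le_finrank_of_injective hg)
  have hs := (LinearMap.injective_iff_surjective_of_finrank_eq_finrank hd).1 hf
  apply le_antisymm
  · rintro _ ⟨x, hx, rfl⟩
    exact m1 x hx
  · intro y hy
    obtain ⟨x, hx⟩ := hs ⟨y, hy⟩
    exact ⟨x, x.2, congrArg Subtype.val hx⟩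

def lowerOp (N m : ℕ) : MvPolynomial (Fin N) ℂ →ₗ[ℂ] MvPolynomial (Fin N) ℂ :=
  ∑ i : Fin N, ((m : ℂ) • (pderiv i).toLinearMap -
    (LinearMap.mulLeft ℂ (X i)) ∘ₗ (pderiv i).toLinearMap ∘ₗ (pderiv i).toLinearMap)

theorem lowerOp_apply (N m : ℕ) (p : MvPolynomial (Fin N) ℂ) :
    lowerOp N m p = ∑ i : Fin N, ((m : MvPolynomial (Fin N) ℂ) * pderiv i p
      - X i * pderiv i (pderiv i p)) := by
  simp [lowerOp, LinearMap.sum_apply, MvPolynomial.smul_eq_C_mul]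

theorem jac_eq (N m : ℕ) :
    jacobianIdeal (∑ i : Fin N, (X i : MvPolynomial (Fin N) ℂ) ^ (m + 2)) =
      Ideal.span (Set.range fun i : Fin N => (X i : MvPolynomial (Fin N) ℂ) ^ (m + 1)) := by
  have h : ∀ i : Fin N, pderiv i (∑ i : Fin N, (X i : MvPolynomial (Fin N) ℂ) ^ (m + 2)) =
      C ((m : ℂ) + 2) * X i ^ (m + 1) := by
    intro i
    rw [map_sum, Finset.sum_eq_single i]
    · rw [pderiv_pow, pderiv_X_self]; simp; exact (map_ofNat C 2).symm
    · intro j _ hj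
      rw [pderiv_pow, pderiv_X_of_ne hj, mul_zero]
    · simp
  have h2 : ((m : ℂ) + 2) ≠ 0 := by
    have : ((m + 2 : ℕ) : ℂ) ≠ 0 := by exact_mod_cast (by omega : m + 2 ≠ 0)
    simpa using this
  unfold jacobianIdeal
  apply le_antisymm <;> rw [Ideal.span_le] <;> rintro _ ⟨i, rfl⟩
  · simp only [h]
    exact Ideal.mul_mem_left _ _ (Ideal.subset_span ⟨i, rfl⟩)
  · have : (X i : MvPolynomial (Fin N) ℂ) ^ (m + 1) = C (((m : ℂ) + 2)⁻¹) *
        pderiv i (∑ i : Fin N, (X i : MvPolynomial (Fin N) ℂ) ^ (m + 2)) := by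
      rw [h, ← mul_assoc, ← C_mul, inv_mul_cancel₀ h2, C_1, one_mul]
    simp only [this]
    exact Ideal.mul_mem_left _ _ (Ideal.subset_span ⟨i, rfl⟩)

theorem lowerOp_mem (N m : ℕ) (p : MvPolynomial (Fin N) ℂ)
    (hp : p ∈ Ideal.span (Set.range fun i : Fin N => (X i : MvPolynomial (Fin N) ℂ) ^ (m + 1))) :
    lowerOp N m p ∈
      Ideal.span (Set.range fun i : Fin N => (X i : MvPolynomial (Fin N) ℂ) ^ (m + 1)) := by
  rw [Ideal.mem_span_range_iff_exists_fun] at hp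
  obtain ⟨c, rfl⟩ := hp
  rw [map_sum]
  refine Ideal.sum_mem _ fun j _ => ?_
  rw [lowerOp_apply]
  refine Ideal.sum_mem _ fun i _ => ?_
  have hj : (X j : MvPolynomial (Fin N) ℂ) ^ (m + 1) ∈
    Ideal.span (Set.range fun i : Fin N => (X i : MvPolynomial (Fin N) ℂ) ^ (m + 1)) :=
    Ideal.subset_span ⟨j, rfl⟩
  generalize c j = p
  by_cases hij : j = i
  · subst hij
    have : (m : MvPolynomial (Fin N) ℂ) * pderiv j (p * X j ^ (m + 1))
      - X j * pderiv j (pderiv j (p * X j ^ (m + 1))) =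
      ((m : MvPolynomial (Fin N) ℂ) * pderiv j p - X j * pderiv j (pderiv j p) - 2 * ((m : MvPolynomial (Fin N) ℂ) + 1) * pderiv j p) * X j ^ (m + 1) := by
      cases m with
      | zero => simp [pderiv_mul]; ring
      | succ k =>
        simp [pderiv_mul, pderiv_pow]; ring
    rw [this]
    exact Ideal.mul_mem_left _ _ hj
  · have : (m : MvPolynomial (Fin N) ℂ) * pderiv i (p * X j ^ (m + 1))
      - X i * pderiv i (pderiv i (p * X j ^ (m + 1))) =
      ((m : MvPolynomial (Fin N) ℂ) * pderiv i p - X i * pderiv i (pderiv i p)) * X j ^ (m + 1) := by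
      simp [pderiv_mul, pderiv_pow, pderiv_X_of_ne hij]; ring
    rw [this]
    exact Ideal.mul_mem_left _ _ hj

theorem lowerOp_comm (N m k : ℕ) (p : MvPolynomial (Fin N) ℂ) (hp : p.IsHomogeneous k) :
    lowerOp N m ((∑ i, X i) * p) = (∑ i, X i) * lowerOp N m p
      + (((N * m : ℤ) - 2 * k : ℤ) : ℂ) • p := by
  have hl : ∀ i : Fin N, pderiv i (∑ i, X i : MvPolynomial (Fin N) ℂ) = 1 := by
    intro i
    rw [map_sum, Finset.sum_eq_single i]
    · simp
    · intro j _ hj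
      rw [pderiv_X_of_ne hj]
    · simp
  have he := hp.sum_X_mul_pderiv
  rw [lowerOp_apply, lowerOp_apply]
  generalize (∑ i, X i : MvPolynomial (Fin N) ℂ) = l at *
  have : ∀ i : Fin N, (m : MvPolynomial (Fin N) ℂ) * pderiv i (l * p)
      - X i * pderiv i (pderiv i (l * p)) =
      l * ((m : MvPolynomial (Fin N) ℂ) * pderiv i p - X i * pderiv i (pderiv i p)) + (m : MvPolynomial (Fin N) ℂ) * p - 2 * (X i * pderiv i p) := by
    intro i
    simp [pderiv_mul, hl]; ring
  simp_rw [this]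
  rw [Finset.sum_sub_distrib, Finset.sum_add_distrib, ← Finset.mul_sum, ← Finset.mul_sum, ← Finset.mul_sum, he]
  have c2 : (C (2 : ℂ) : MvPolynomial (Fin N) ℂ) = 2 := map_ofNat C 2
  simp [MvPolynomial.smul_eq_C_mul, c2]
  ring

theorem lowerOp_hom (N m k : ℕ) (p : MvPolynomial (Fin N) ℂ) (hp : p.IsHomogeneous (k + 1)) :
    (lowerOp N m p).IsHomogeneous k := by
  rw [lowerOp_apply]
  refine IsHomogeneous.sum _ _ _ fun i _ => ?_
  have h1 : (pderiv i p).IsHomogeneous k := hp.pderiv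
  refine IsHomogeneous.sub ?_ ?_
  · have := (isHomogeneous_C (Fin N) (m : ℂ)).mul h1
    simpa using this
  · cases k with
    | zero =>
      have : pderiv i (pderiv i p) = 0 := by
        rw [← totalDegree_zero_iff_isHomogeneous, totalDegree_eq_zero_iff_eq_C] at h1
        rw [h1, pderiv_C]
      rw [this, mul_zero]
      exact isHomogeneous_zero _ _ _
    | succ k =>
      have h2 : (pderiv i (pderiv i p)).IsHomogeneous k := h1.pderiv
      have := (isHomogeneous_X ℂ i).mul h2
      rwa [add_comm] at this

theorem lowerOp_hom_zero (N m : ℕ) (p : MvPolynomial (Fin N) ℂ) (hp : p.IsHomogeneous 0) :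
    lowerOp N m p = 0 := by
  rw [← totalDegree_zero_iff_isHomogeneous, totalDegree_eq_zero_iff_eq_C] at hp
  rw [lowerOp_apply, hp]
  simp

theorem high_mem (N m k : ℕ) (hk : N * m < k) (p : MvPolynomial (Fin N) ℂ)
    (hp : p.IsHomogeneous k) :
    p ∈ Ideal.span (Set.range fun i : Fin N => (X i : MvPolynomial (Fin N) ℂ) ^ (m + 1)) := by
  rw [p.as_sum]
  refine Ideal.sum_mem _ fun v hv => ?_
  have hdeg : v.degree = k := by
    by_contra h
    exact (mem_support_iff.1 hv) (hp.coeff_eq_zero h)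
  obtain ⟨i, hi⟩ : ∃ i, m + 1 ≤ v i := by
    by_contra! h
    have : v.degree ≤ N * m := by
      rw [Finsupp.degree_eq_sum]
      calc ∑ i, v i ≤ ∑ i : Fin N, m := Finset.sum_le_sum fun i _ => by have := h i; omega
        _ = N * m := by simp
    omega
  have h1 : (X i : MvPolynomial (Fin N) ℂ) ^ (m + 1) ∣ monomial v (coeff v p) := by
    rw [X_pow_eq_monomial, monomial_dvd_monomial]
    refine ⟨Or.inr ?_, one_dvd _⟩
    rwa [Finsupp.single_le_iff]
  exact Ideal.mem_of_dvd _ h1 (Ideal.subset_span ⟨i, rfl⟩)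

theorem exists_desc {N : ℕ} (I : Ideal (MvPolynomial (Fin N) ℂ))
    (D : MvPolynomial (Fin N) ℂ →ₗ[ℂ] MvPolynomial (Fin N) ℂ) (hD : ∀ p ∈ I, D p ∈ I) :
    ∃ g : (MvPolynomial (Fin N) ℂ ⧸ I) →ₗ[ℂ] (MvPolynomial (Fin N) ℂ ⧸ I),
      ∀ p, g (Ideal.Quotient.mk I p) = Ideal.Quotient.mk I (D p) := by
  let π := (Ideal.Quotient.mkₐ ℂ I).toLinearMap
  obtain ⟨s, hs⟩ := LinearMap.exists_rightInverse_of_surjective π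
    (LinearMap.range_eq_top.2 (Ideal.Quotient.mkₐ_surjective ℂ I))
  refine ⟨π ∘ₗ D ∘ₗ s, fun p => ?_⟩
  change Ideal.Quotient.mk I (D (s (π p))) = _
  rw [Ideal.Quotient.eq, ← map_sub]
  apply hD
  rw [← Ideal.Quotient.eq]
  exact LinearMap.congr_fun hs (π p)

def zPiece {N : ℕ} (I : Ideal (MvPolynomial (Fin N) ℂ)) : ℤ →
    Submodule ℂ (MvPolynomial (Fin N) ℂ ⧸ I)
  | Int.ofNat k => gradedPiece I k
  | Int.negSucc _ => ⊥

theorem mulMap_pow {N : ℕ} (I : Ideal (MvPolynomial (Fin N) ℂ)) (g : MvPolynomial (Fin N) ℂ)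
    (j : ℕ) : mulMap I (g ^ j) = mulMap I g ^ j := by
  unfold mulMap
  rw [LinearMap.pow_mulLeft, map_pow]

theorem mono_lefschetz (N m a w : ℕ) (h : N * m = 2 * a + w)
    (I : Ideal (MvPolynomial (Fin N) ℂ))
    (hI : I = Ideal.span (Set.range fun i : Fin N => (X i : MvPolynomial (Fin N) ℂ) ^ (m + 1))) :
    (∀ x ∈ gradedPiece I a, mulMap I ((∑ i, X i) ^ w) x = 0 → x = 0) ∧
      (gradedPiece I a).map (mulMap I ((∑ i, X i) ^ w)) = gradedPiece I (a + w) := by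
  obtain ⟨F, hF⟩ := exists_desc I (lowerOp N m) (by
    intro p hp; rw [hI] at hp ⊢; exact lowerOp_mem N m p hp)
  have hE : ∀ p, mulMap I (∑ i, X i) (Ideal.Quotient.mk I p) =
    Ideal.Quotient.mk I ((∑ i, X i) * p) := fun p => (map_mul _ _ _).symm
  have hl : (∑ i, X i : MvPolynomial (Fin N) ℂ).IsHomogeneous 1 :=
    IsHomogeneous.sum _ _ _ fun i _ => isHomogeneous_X ℂ i
  rw [mulMap_pow]
  refine sl2_bij (zPiece I) (mulMap I (∑ i, X i)) F (N * m : ℤ) ?_ ?_ ?_ ?_ ?_ ?_ a w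
    (by exact_mod_cast h)
  · rintro (k | k)
    · have : FiniteDimensional ℂ (homogeneousSubmodule (Fin N) ℂ k) :=
        Module.Finite.iff_fg.2 (homogeneousSubmodule_fg _ _ k)
      change FiniteDimensional ℂ (gradedPiece I k)
      unfold gradedPiece
      infer_instance
    · change FiniteDimensional ℂ (⊥ : Submodule ℂ (MvPolynomial (Fin N) ℂ ⧸ I))
      infer_instance
  · rintro (k | k) x hx
    · obtain ⟨p, hp, rfl⟩ := hx
      change _ ∈ gradedPiece I (k + 1)
      refine ⟨(∑ i, X i) * p, ?_, (hE p).symm⟩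
      have := hl.mul hp
      rwa [add_comm] at this
    · have : x = 0 := hx
      rw [this, map_zero]; exact zero_mem _
  · rintro (k | k) x hx
    · obtain ⟨p, hp, rfl⟩ := hx
      have e := hF p
      change F (Ideal.Quotient.mk I p) ∈ _
      rw [e]
      cases k with
      | zero => rw [lowerOp_hom_zero N m p hp, map_zero]; exact zero_mem _
      | succ k =>
        have : (Int.ofNat (k + 1) - 1 : ℤ) = Int.ofNat k := by simp
        rw [this]
        exact ⟨_, lowerOp_hom N m k p hp, rfl⟩
    · have : x = 0 := hx
      rw [this, map_zero]; exact zero_mem _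
  · rintro (k | k) x hx
    · obtain ⟨p, hp, rfl⟩ := hx
      change F (mulMap I _ (Ideal.Quotient.mk I p)) = mulMap I _ (F (Ideal.Quotient.mk I p)) + 
        _ • (Ideal.Quotient.mk I p)
      rw [hE, hF, hF, hE, lowerOp_comm N m k p hp, map_add]
      rfl
    · have : x = 0 := hx
      rw [this]; simp
  · intro x hx; exact hx
  · intro x hx
    have : (N * m + 1 : ℤ) = Int.ofNat (N * m + 1) := by simp
    rw [this] at hx
    obtain ⟨p, hp, rfl⟩ := hx
    apply Ideal.Quotient.eq_zero_iff_mem.2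
    rw [hI]
    exact high_mem N m _ (Nat.lt_succ_self _) p hp

/-- For the Fermat hypersurface `F = x_0^d + ⋯ + x_{n+1}^d` with `d ≥ n+2`, multiplication by
`(x_0 + ⋯ + x_{n+1})^{nd}` maps `R(F)_{d-(n+2)}` bijectively onto `R(F)_{(n+1)d-(n+2)}`. -/
theorem fermat_strong_lefschetz_bijective
    (n d : ℕ) (hn : 1 ≤ n) (hd : n + 2 ≤ d) :
    (∀ x ∈ gradedPiece (jacobianIdeal (∑ i : Fin (n + 2), (X i : MvPolynomial (Fin (n + 2)) ℂ) ^ d)) (d - (n + 2)),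
        mulMap (jacobianIdeal (∑ i : Fin (n + 2), (X i : MvPolynomial (Fin (n + 2)) ℂ) ^ d))
          ((∑ i : Fin (n + 2), (X i : MvPolynomial (Fin (n + 2)) ℂ)) ^ (n * d)) x = 0 → x = 0) ∧
    (gradedPiece (jacobianIdeal (∑ i : Fin (n + 2), (X i : MvPolynomial (Fin (n + 2)) ℂ) ^ d)) (d - (n + 2))).map
        (mulMap (jacobianIdeal (∑ i : Fin (n + 2), (X i : MvPolynomial (Fin (n + 2)) ℂ) ^ d))
          ((∑ i : Fin (n + 2), (X i : MvPolynomial (Fin (n + 2)) ℂ)) ^ (n * d)))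
      = gradedPiece (jacobianIdeal (∑ i : Fin (n + 2), (X i : MvPolynomial (Fin (n + 2)) ℂ) ^ d)) ((n + 1) * d - (n + 2)) := by
  obtain ⟨c, rfl⟩ := Nat.exists_eq_add_of_le hd
  have h := mono_lefschetz (n + 2) (n + c) c (n * (n + 2 + c)) (by ring) _ (jac_eq (n + 2) (n + c))
  have e1 : n + 2 + c - (n + 2) = c := by omega
  have e2 : (n + 1) * (n + 2 + c) - (n + 2) = c + n * (n + 2 + c) := by
    have : (n + 1) * (n + 2 + c) = c + n * (n + 2 + c) + (n + 2) := by ring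
    omega
  have e3 : n + c + 2 = n + 2 + c := by ring
  rw [e3] at h
  rw [e1, e2]
  exact h
end
end

section
/- (Strong Lefschetz property of monomial complete intersections.) Let N ≥ 1 and e ≥ 2, and let A = ℂ[x_1,…,x_N] ⧸ (x_1^e,…,x_N^e). Let ℓ be the residue class of x_1 + ⋯ + x_N. Then for all k, m ∈ ℕ, the multiplication map ×ℓ^m : A_k → A_{k+m} has rank equal to min(dim_ℂ A_k, dim_ℂ A_{k+m}). -/
noncomputable section

open MvPolynomial

theorem sl2_pow {V : Type*} [AddCommGroup V] [Module ℂ V] (A : ℕ → Submodule ℂ V)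
    (L D : V →ₗ[ℂ] V) (s : ℕ) (hL : ∀ k, ∀ v ∈ A k, L v ∈ A (k+1))
    (hc : ∀ k, ∀ v ∈ A k, D (L v) = L (D v) + ((s:ℂ) - 2 * k) • v) (m : ℕ) :
    ∀ k, ∀ v ∈ A k, (L^m) v ∈ A (k+m) ∧
      D ((L^(m+1)) v) = (L^(m+1)) (D v) + (((m:ℂ)+1) * ((s:ℂ) - 2 * k - m)) • (L^m) v := by
  induction m with
  | zero => intro k v hv; simpa using ⟨hv, hc k v hv⟩
  | succ m ih =>
    intro k v hv
    obtain ⟨h1, h2⟩ := ih k v hv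
    have h3 : (L^(m+1)) v ∈ A (k+(m+1)) := by
      rw [pow_succ', Module.End.mul_apply]; exact hL _ _ h1
    refine ⟨h3, ?_⟩
    rw [pow_succ' L (m+1), Module.End.mul_apply, hc _ _ h3, h2, map_add, map_smul,
      Module.End.mul_apply, ← Module.End.mul_apply L (L^m), ← pow_succ', add_assoc, ← add_smul]
    congr 2
    push_cast; ring

theorem sl2_inj_s3 {V : Type*} [AddCommGroup V] [Module ℂ V] (A : ℕ → Submodule ℂ V)
    (L D : V →ₗ[ℂ] V) (s : ℕ) (hL : ∀ k, ∀ v ∈ A k, L v ∈ A (k+1))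
    (hD : ∀ k, ∀ v ∈ A (k+1), D v ∈ A k) (h0 : ∀ v ∈ A 0, D v = 0)
    (hc : ∀ k, ∀ v ∈ A k, D (L v) = L (D v) + ((s:ℂ) - 2 * k) • v) (k : ℕ) :
    ∀ m, 2 * k + m ≤ s → ∀ v ∈ A k, (L^m) v = 0 → v = 0 := by
  induction k with
  | zero =>
    intro m
    induction m with
    | zero => intro _ v _ h; simpa using h
    | succ m ih =>
      intro hm v hv h
      have := (sl2_pow A L D s hL hc m 0 v hv).2
      rw [h, h0 v hv, map_zero, map_zero, zero_add] at this
      refine ih (by omega) v hv ((smul_eq_zero.mp this.symm).resolve_left ?_)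
      obtain ⟨t, rfl⟩ := Nat.exists_eq_add_of_le hm
      have : ((m:ℂ)+1) * ((t:ℂ)+1) ≠ 0 := mul_ne_zero (by exact_mod_cast m.succ_ne_zero) (by exact_mod_cast t.succ_ne_zero)
      convert this using 1
      push_cast; ring
  | succ k ihk =>
    intro m
    induction m with
    | zero => intro _ v _ h; simpa using h
    | succ m ih =>
      intro hm v hv h
      have key := (sl2_pow A L D s hL hc m (k+1) v hv).2
      have hne : ((m:ℂ)+1) * ((s:ℂ) - 2 * ((k+1:ℕ):ℂ) - m) ≠ 0 := by
        obtain ⟨t, rfl⟩ := Nat.exists_eq_add_of_le hm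
        have : ((m:ℂ)+1) * ((t:ℂ)+1) ≠ 0 := mul_ne_zero (by exact_mod_cast m.succ_ne_zero) (by exact_mod_cast t.succ_ne_zero)
        convert this using 1
        push_cast; ring
      set c := ((m:ℂ)+1) * ((s:ℂ) - 2 * ((k+1:ℕ):ℂ) - m)
      rw [h, map_zero] at key
      have e1 : L (D v) + c • v = 0 := by
        apply ih (by omega) _ (add_mem (hL _ _ (hD _ _ hv)) ((A _).smul_mem _ hv))
        rw [map_add, map_smul, ← Module.End.mul_apply, ← pow_succ, ← key]
      have e2 : D v = 0 := by
        apply ihk (m+2) (by omega) _ (hD _ _ hv)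
        rw [pow_succ, Module.End.mul_apply, eq_neg_of_add_eq_zero_left e1, map_neg, map_smul, h]
        simp
      rw [e2, map_zero, zero_add] at e1
      exact (smul_eq_zero.mp e1).resolve_left hne

theorem sl2_surj {V : Type*} [AddCommGroup V] [Module ℂ V] (A : ℕ → Submodule ℂ V)
    (L D : V →ₗ[ℂ] V) (s : ℕ) (hL : ∀ k, ∀ v ∈ A k, L v ∈ A (k+1))
    (hD : ∀ k, ∀ v ∈ A (k+1), D v ∈ A k) (h0 : ∀ v ∈ A 0, D v = 0)
    (hc : ∀ k, ∀ v ∈ A k, D (L v) = L (D v) + ((s:ℂ) - 2 * k) • v)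
    (hz : ∀ k, s < k → ∀ v ∈ A k, v = 0) (n : ℕ) :
    ∀ m k, s < k + m + n → s ≤ 2 * k + m → ∀ v ∈ A (k + m), ∃ w ∈ A k, (L^m) w = v := by
  have hLD : ∀ k, ∀ v ∈ A k, L (D v) ∈ A k := by
    intro k v hv
    cases k with
    | zero => rw [h0 v hv, map_zero]; exact zero_mem _
    | succ k => exact hL _ _ (hD _ _ hv)
  induction n with
  | zero => intro m k h1 h2 v hv; exact ⟨0, zero_mem _, by rw [hz _ h1 v hv, map_zero]⟩
  | succ n ihn =>
    intro m
    induction m with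
    | zero => intro k h1 h2 v hv; exact ⟨v, hv, by simp⟩
    | succ m ihm =>
      intro k h1 h2 v hv
      obtain ⟨u, hu, huv⟩ := ihm (k+1) (by omega) (by omega) v (by convert hv using 2; omega)
      obtain ⟨w, hw, hwv⟩ := ihn (m+2) k (by omega) (by omega) (L v) (hL _ _ hv)
      have k1 := (sl2_pow A L D s hL hc m (k+1) u hu).2
      have k2 := (sl2_pow A L D s hL hc (m+1) k w hw).2
      have hne : ((m:ℂ)+1) * ((s:ℂ) - 2 * ((k+1:ℕ):ℂ) - m) ≠ 0 := by
        obtain ⟨t, ht⟩ := Nat.exists_eq_add_of_le h2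
        have : ((m:ℂ)+1) * ((t:ℂ)+1) ≠ 0 := mul_ne_zero (by exact_mod_cast m.succ_ne_zero) (by exact_mod_cast t.succ_ne_zero)
        have ht' : (2:ℂ) * k + (m+1) = s + t := by exact_mod_cast ht
        rw [← neg_ne_zero]
        convert this using 1
        push_cast
        linear_combination ((m:ℂ)+1) * ht'
      set c := ((m:ℂ)+1) * ((s:ℂ) - 2 * ((k+1:ℕ):ℂ) - m)
      set c' := (((m+1:ℕ):ℂ)+1) * ((s:ℂ) - 2 * k - ((m+1:ℕ):ℂ))
      refine ⟨c⁻¹ • (L (D w) + c' • w - D u),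
        (A k).smul_mem _ (sub_mem (add_mem (hLD _ _ hw) ((A k).smul_mem _ hw)) (hD _ _ hu)), ?_⟩
      rw [pow_succ' L m, Module.End.mul_apply, huv] at k1
      rw [hwv, k1] at k2
      rw [map_smul, inv_smul_eq_iff₀ hne, map_sub, map_add, map_smul, ← Module.End.mul_apply (L^(m+1)) L,
        ← pow_succ, ← k2, pow_succ' L m]
      abel

def lamPoly (N d : ℕ) : MvPolynomial (Fin N) ℂ →ₗ[ℂ] MvPolynomial (Fin N) ℂ :=
  ∑ j : Fin N, ((d : ℂ) • (pderiv j).toLinearMap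
    - (LinearMap.mulLeft ℂ (X j)) ∘ₗ (pderiv j).toLinearMap ∘ₗ (pderiv j).toLinearMap)

theorem lamPoly_apply (N d : ℕ) (f : MvPolynomial (Fin N) ℂ) :
    lamPoly N d f = ∑ j : Fin N, ((d : MvPolynomial (Fin N) ℂ) * pderiv j f
      - X j * pderiv j (pderiv j f)) := by
  simp [lamPoly, smul_eq_C_mul]

theorem lamPoly_hom (N d k : ℕ) (f : MvPolynomial (Fin N) ℂ) (hf : f.IsHomogeneous (k+1)) :
    (lamPoly N d f).IsHomogeneous k := by
  rw [lamPoly_apply]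
  apply IsHomogeneous.sum
  intro j _
  have h1 : (pderiv j f).IsHomogeneous k := hf.pderiv
  apply IsHomogeneous.sub
  · have := (isHomogeneous_C (Fin N) (d:ℂ)).mul h1
    simpa using this
  · cases k with
    | zero =>
      rw [← totalDegree_zero_iff_isHomogeneous, totalDegree_eq_zero_iff_eq_C] at h1
      rw [h1, pderiv_C, mul_zero]
      exact isHomogeneous_zero _ _ _
    | succ k =>
      have := (isHomogeneous_X ℂ j).mul (h1.pderiv (i := j))
      rwa [show 1 + (k + 1 - 1) = k + 1 by omega] at this

theorem lamPoly_zero (N d : ℕ) (f : MvPolynomial (Fin N) ℂ) (hf : f.IsHomogeneous 0) :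
    lamPoly N d f = 0 := by
  rw [← totalDegree_zero_iff_isHomogeneous, totalDegree_eq_zero_iff_eq_C] at hf
  rw [hf, lamPoly_apply]
  simp

theorem lamPoly_comm (N d k : ℕ) (f : MvPolynomial (Fin N) ℂ) (hf : f.IsHomogeneous k) :
    lamPoly N d ((∑ i, X i) * f) = (∑ i, X i) * lamPoly N d f
      + (((N * d : ℕ) : ℂ) - 2 * k) • f := by
  have hs : ∀ j : Fin N, pderiv j (∑ i : Fin N, X i : MvPolynomial (Fin N) ℂ) = 1 := by
    intro j
    rw [map_sum, Finset.sum_eq_single j]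
    · simp
    · intro b _ hb; exact pderiv_X_of_ne hb
    · simp
  have hE := hf.sum_X_mul_pderiv
  rw [lamPoly_apply, lamPoly_apply]
  set S : MvPolynomial (Fin N) ℂ := ∑ i : Fin N, X i with hS
  have : ∀ j : Fin N, (d : MvPolynomial (Fin N) ℂ) * pderiv j (S * f)
      - X j * pderiv j (pderiv j (S * f)) =
      S * ((d : MvPolynomial (Fin N) ℂ) * pderiv j f - X j * pderiv j (pderiv j f))
      + ((d : MvPolynomial (Fin N) ℂ) * f - 2 * (X j * pderiv j f)) := by
    intro j
    simp only [pderiv_mul, hs, map_add, pderiv_one]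
    ring
  simp only [this]
  rw [Finset.sum_add_distrib, Finset.sum_sub_distrib, ← Finset.mul_sum,
    ← Finset.mul_sum Finset.univ (fun j => X j * pderiv j f), hE]
  have hC2 : (C (2:ℂ) : MvPolynomial (Fin N) ℂ) = 2 := map_ofNat C 2
  simp [smul_eq_C_mul, hC2]
  ring

theorem lamPoly_ideal' (N d : ℕ) (f : MvPolynomial (Fin N) ℂ)
    (hf : f ∈ Ideal.span (Set.range fun i : Fin N => (X i : MvPolynomial (Fin N) ℂ) ^ (d+1))) :
    lamPoly N d f ∈ Ideal.span (Set.range fun i : Fin N => (X i : MvPolynomial (Fin N) ℂ) ^ (d+1)) := by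
  obtain ⟨c, rfl⟩ := (Ideal.mem_span_range_iff_exists_fun).mp hf
  rw [map_sum]
  refine sum_mem fun i _ => ?_
  rw [lamPoly_apply]
  refine sum_mem fun j _ => ?_
  have hg : (X i : MvPolynomial (Fin N) ℂ) ^ (d+1) ∈ Ideal.span (Set.range fun i : Fin N => (X i : MvPolynomial (Fin N) ℂ) ^ (d+1)) :=
    Ideal.subset_span ⟨i, rfl⟩
  by_cases hij : i = j
  · subst hij
    have : (d : MvPolynomial (Fin N) ℂ) * pderiv i (c i * X i ^ (d+1))
        - X i * pderiv i (pderiv i (c i * X i ^ (d+1)))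
        = ((d : MvPolynomial (Fin N) ℂ) * pderiv i (c i) - X i * pderiv i (pderiv i (c i)) - 2 * ((d : MvPolynomial (Fin N) ℂ)+1) * pderiv i (c i)) * X i ^ (d+1) := by
      have h1 : pderiv i ((X i : MvPolynomial (Fin N) ℂ) ^ (d+1)) = ((d : MvPolynomial (Fin N) ℂ)+1) * X i ^ d := by
        rw [pderiv_pow]; simp
      have h2 : X i * pderiv i ((X i : MvPolynomial (Fin N) ℂ) ^ d) = (d : MvPolynomial (Fin N) ℂ) * X i ^ d := by
        rw [pderiv_pow]; cases d <;> simp; ring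
      have h3 : pderiv i ((d : MvPolynomial (Fin N) ℂ) + 1) = 0 := by
        simp
      simp only [pderiv_mul, map_add, h1, h3]
      linear_combination (- c i * (d + 1)) * h2
    rw [this]
    exact Ideal.mul_mem_left _ _ hg
  · have : (d : MvPolynomial (Fin N) ℂ) * pderiv j (c i * X i ^ (d+1))
        - X j * pderiv j (pderiv j (c i * X i ^ (d+1)))
        = ((d : MvPolynomial (Fin N) ℂ) * pderiv j (c i) - X j * pderiv j (pderiv j (c i))) * X i ^ (d+1) := by
      have h1 : pderiv j ((X i : MvPolynomial (Fin N) ℂ) ^ (d+1)) = 0 := by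
        rw [pderiv_pow, pderiv_X_of_ne hij, mul_zero]
      simp only [pderiv_mul, map_add, h1, mul_zero, map_zero, add_zero]
      ring
    rw [this]
    exact Ideal.mul_mem_left _ _ hg

theorem hom_vanish (N d k : ℕ) (hk : N * d < k) (f : MvPolynomial (Fin N) ℂ) (hf : f.IsHomogeneous k) :
    f ∈ Ideal.span (Set.range fun i : Fin N => (X i : MvPolynomial (Fin N) ℂ) ^ (d+1)) := by
  rw [f.as_sum]
  refine sum_mem fun a ha => ?_
  have hdeg : ∑ i, a i = k := by
    rw [← Finsupp.degree_eq_sum]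
    rw [Finsupp.degree_eq_weight_one]
    exact hf (mem_support_iff.mp ha)
  obtain ⟨i, hi⟩ : ∃ i, d + 1 ≤ a i := by
    by_contra! h
    have : ∑ i : Fin N, a i ≤ ∑ i : Fin N, d := Finset.sum_le_sum fun i _ => by have := h i; omega
    simp at this
    omega
  refine Ideal.mem_of_dvd _ (?_ : (X i : MvPolynomial (Fin N) ℂ) ^ (d+1) ∣ _) (Ideal.subset_span ⟨i, rfl⟩)
  rw [X_pow_eq_monomial, monomial_dvd_monomial]
  exact ⟨Or.inr (Finsupp.single_le_iff.mpr hi), one_dvd _⟩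

def lamQ (N d : ℕ) (I : Ideal (MvPolynomial (Fin N) ℂ))
    (hI : I = Ideal.span (Set.range fun i : Fin N => (X i : MvPolynomial (Fin N) ℂ) ^ (d+1))) :
    (MvPolynomial (Fin N) ℂ ⧸ I) →ₗ[ℂ] (MvPolynomial (Fin N) ℂ ⧸ I) :=
  (Submodule.Quotient.restrictScalarsEquiv ℂ I).toLinearMap ∘ₗ
    (Submodule.mapQ (I.restrictScalars ℂ) (I.restrictScalars ℂ) (lamPoly N d)
      (fun x hx => by subst hI; exact lamPoly_ideal' N d x hx)) ∘ₗ
    (Submodule.Quotient.restrictScalarsEquiv ℂ I).symm.toLinearMap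

theorem lamQ_mk (N d : ℕ) (I : Ideal (MvPolynomial (Fin N) ℂ))
    (hI : I = Ideal.span (Set.range fun i : Fin N => (X i : MvPolynomial (Fin N) ℂ) ^ (d+1)))
    (f : MvPolynomial (Fin N) ℂ) :
    lamQ N d I hI (Ideal.Quotient.mk I f) = Ideal.Quotient.mk I (lamPoly N d f) := rfl

theorem mem_gp {N : ℕ} (I : Ideal (MvPolynomial (Fin N) ℂ)) (k : ℕ) (v) :
    v ∈ gradedPiece I k ↔ ∃ f : MvPolynomial (Fin N) ℂ, f.IsHomogeneous k ∧ Ideal.Quotient.mk I f = v := Iff.rfl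

instance gp_fin {N : ℕ} (I : Ideal (MvPolynomial (Fin N) ℂ)) (k : ℕ) :
    Module.Finite ℂ (gradedPiece I k) := by
  unfold gradedPiece
  have : Module.Finite ℂ (homogeneousSubmodule (Fin N) ℂ k) :=
    Submodule.finiteDimensional_of_le (S₂ := restrictTotalDegree (Fin N) ℂ k) fun f hf =>
      (mem_restrictTotalDegree _ _ _).mpr (IsHomogeneous.totalDegree_le hf)
  infer_instance

/-- Strong Lefschetz property of the monomial complete intersection
`A = ℂ[x_1,…,x_N] ⧸ (x_1^e,…,x_N^e)`: multiplication by `(x_1 + ⋯ + x_N)^m` has maximal rank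
from `A_k` to `A_{k+m}` for all `k, m`. -/
theorem monomial_complete_intersection_strong_lefschetz
    (N e : ℕ) (hN : 1 ≤ N) (he : 2 ≤ e) (k m : ℕ) :
    Module.finrank ℂ
        ((gradedPiece (Ideal.span (Set.range fun i : Fin N => (X i : MvPolynomial (Fin N) ℂ) ^ e)) k).map
          (mulMap (Ideal.span (Set.range fun i : Fin N => (X i : MvPolynomial (Fin N) ℂ) ^ e))
            ((∑ i : Fin N, (X i : MvPolynomial (Fin N) ℂ)) ^ m)))
      = min
          (Module.finrank ℂ
            (gradedPiece (Ideal.span (Set.range fun i : Fin N => (X i : MvPolynomial (Fin N) ℂ) ^ e)) k))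
          (Module.finrank ℂ
            (gradedPiece (Ideal.span (Set.range fun i : Fin N => (X i : MvPolynomial (Fin N) ℂ) ^ e)) (k + m))) := by
  obtain ⟨d, rfl⟩ : ∃ d, e = d + 1 := ⟨e - 1, by omega⟩
  generalize hI : Ideal.span (Set.range fun i : Fin N => (X i : MvPolynomial (Fin N) ℂ) ^ (d+1)) = I
  have hpow : mulMap I ((∑ i : Fin N, (X i : MvPolynomial (Fin N) ℂ)) ^ m)
      = (mulMap I (∑ i : Fin N, (X i : MvPolynomial (Fin N) ℂ))) ^ m := by
    simp only [mulMap, map_pow, LinearMap.pow_mulLeft]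
  rw [hpow]
  set L := mulMap I (∑ i : Fin N, (X i : MvPolynomial (Fin N) ℂ)) with hLdef
  have hLmk : ∀ f, L (Ideal.Quotient.mk I f) = Ideal.Quotient.mk I ((∑ i, X i) * f) := fun f => rfl
  have hL : ∀ k, ∀ v ∈ gradedPiece I k, L v ∈ gradedPiece I (k+1) := by
    rintro k v ⟨f, hf, rfl⟩
    refine ⟨(∑ i, X i) * f, ?_, rfl⟩
    have h1 : (∑ i : Fin N, (X i : MvPolynomial (Fin N) ℂ)).IsHomogeneous 1 :=
      IsHomogeneous.sum _ _ _ fun i _ => isHomogeneous_X ℂ i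
    have := h1.mul hf
    rw [add_comm] at this
    exact this
  have hD : ∀ k, ∀ v ∈ gradedPiece I (k+1), lamQ N d I hI.symm v ∈ gradedPiece I k := by
    rintro k v ⟨f, hf, rfl⟩
    exact ⟨lamPoly N d f, lamPoly_hom N d k f hf, rfl⟩
  have h0 : ∀ v ∈ gradedPiece I 0, lamQ N d I hI.symm v = 0 := by
    rintro v ⟨f, hf, rfl⟩
    change Ideal.Quotient.mk I (lamPoly N d f) = 0
    rw [lamPoly_zero N d f hf, map_zero]
  have hc : ∀ k, ∀ v ∈ gradedPiece I k, lamQ N d I hI.symm (L v)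
      = L (lamQ N d I hI.symm v) + (((N * d : ℕ):ℂ) - 2 * k) • v := by
    rintro k v ⟨f, hf, rfl⟩
    change Ideal.Quotient.mk I (lamPoly N d ((∑ i, X i) * f)) = _
    rw [lamPoly_comm N d k f hf]
    rfl
  have hz : ∀ k, N * d < k → ∀ v ∈ gradedPiece I k, v = 0 := by
    rintro k hk v ⟨f, hf, rfl⟩
    exact Ideal.Quotient.eq_zero_iff_mem.mpr (hI ▸ hom_vanish N d k hk f hf)
  have hle : (gradedPiece I k).map (L^m) ≤ gradedPiece I (k+m) := by
    rintro _ ⟨v, hv, rfl⟩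
    exact (sl2_pow _ L _ _ hL hc m k v hv).1
  have r1 := Submodule.finrank_mono hle
  have r2 := Submodule.finrank_map_le (L^m) (gradedPiece I k)
  rcases le_total (2 * k + m) (N * d) with h | h
  · have hinj := sl2_inj_s3 _ L _ _ hL hD h0 hc k m h
    have : Module.finrank ℂ ((gradedPiece I k).map (L^m)) = Module.finrank ℂ (gradedPiece I k) := by
      rw [← LinearMap.range_domRestrict]
      apply LinearMap.finrank_range_of_inj
      rw [← LinearMap.ker_eq_bot, LinearMap.ker_eq_bot']
      rintro ⟨v, hv⟩ hv0
      exact Subtype.ext (hinj v hv hv0)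
    omega
  · have hsurj := sl2_surj _ L _ _ hL hD h0 hc hz (N * d + 1) m k (by omega) h
    have : (gradedPiece I k).map (L^m) = gradedPiece I (k+m) := by
      refine le_antisymm hle fun v hv => ?_
      obtain ⟨w, hw, rfl⟩ := hsurj v hv
      exact ⟨w, hw, rfl⟩
    rw [this] at r2 ⊢
    omega
end
end

section
/- Let N ≥ 1 and let f_1,…,f_N ∈ ℂ[x_1,…,x_N] be homogeneous polynomials of positive degrees whose only common zero in ℂ^N is the origin. Then f_1,…,f_N is a regular sequence in ℂ[x_1,…,x_N]. -/
noncomputable section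

open MvPolynomial

namespace HomReg

open RingTheory.Sequence IsLocalRing

universe u v

variable {R : Type u} [CommRing R] [IsLocalRing R] [IsNoetherianRing R]

/-- There is a weakly regular sequence of length `n` on `M` inside the maximal ideal. -/
def HasSeq (R : Type u) [CommRing R] [IsLocalRing R] (n : ℕ) (M : Type v) [AddCommGroup M]
    [Module R M] : Prop :=
  ∃ rs : List R, rs.length = n ∧ (∀ r ∈ rs, r ∈ maximalIdeal R) ∧ IsWeaklyRegular M rs

lemma exists_regular (M : Type v) [AddCommGroup M] [Module R M] [Module.Finite R M]
    (h : ∀ v : M, (∀ r ∈ maximalIdeal R, r • v = 0) → v = 0) :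
    ∃ z ∈ maximalIdeal R, IsSMulRegular M z := by
  by_contra! hc
  have hsub : (maximalIdeal R : Set R) ⊆ ⋃ p ∈ associatedPrimes R M, (p : Set R) := by
    rw [biUnion_associatedPrimes_eq_compl_regular]
    intro z hz
    exact hc z hz
  obtain ⟨P, hP, hle⟩ :=
    ((maximalIdeal R).subset_union_prime_finite (associatedPrimes.finite R M) (f := id) 0 0
      fun _ h _ _ ↦ h.1).1 hsub
  obtain ⟨hp, v, hv⟩ := isAssociatedPrime_iff.1 hP
  have hv0 : v = 0 := by
    apply h
    intro r hr
    have : r ∈ P := hle hr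
    rw [hv] at this
    simpa [Submodule.mem_colon] using this
  apply hp.ne_top
  rw [hv, hv0]
  simp

lemma mk_eq_zero_iff {M : Type v} [AddCommGroup M] [Module R M] (x : R) (u : M) :
    (Submodule.Quotient.mk u : QuotSMulTop x M) = 0 ↔ ∃ w : M, u = x • w := by
  rw [Submodule.Quotient.mk_eq_zero, Submodule.mem_smul_pointwise_iff_exists]
  simp [eq_comm]

lemma socle_transfer {M : Type v} [AddCommGroup M] [Module R M] (I : Ideal R) {x y : R}
    (hy : y ∈ I)
    (hx' : IsSMulRegular M x) (hy' : IsSMulRegular M y)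
    (h : ∀ v : QuotSMulTop y M, (∀ r ∈ I, r • v = 0) → v = 0) :
    ∀ v : QuotSMulTop x M, (∀ r ∈ I, r • v = 0) → v = 0 := by
  intro u hu
  obtain ⟨u, rfl⟩ := Submodule.Quotient.mk_surjective _ u
  simp_rw [← Submodule.Quotient.mk_smul, mk_eq_zero_iff] at hu
  obtain ⟨v, hv⟩ := hu y hy
  have := h (Submodule.Quotient.mk v) (by
    intro r hr
    rw [← Submodule.Quotient.mk_smul, mk_eq_zero_iff]
    obtain ⟨w, hw⟩ := hu r hr
    refine ⟨w, hx' ?_⟩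
    change x • r • v = x • y • w
    rw [smul_comm x r, ← hv, smul_comm r y, hw, smul_comm])
  rw [mk_eq_zero_iff] at this ⊢
  obtain ⟨w, rfl⟩ := this
  refine ⟨w, hy' ?_⟩
  change y • u = y • x • w
  rw [hv, smul_comm]

lemma hasSeq_quot (n : ℕ) : ∀ (M : Type v) [AddCommGroup M] [Module R M] [Module.Finite R M]
    (_ : HasSeq R (n + 1) M) (x : R) (_ : x ∈ maximalIdeal R) (_ : IsSMulRegular M x),
    HasSeq R n (QuotSMulTop x M) := by
  induction n with
  | zero => 
    intro M _ _ _ _ x _ _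
    exact ⟨[], rfl, by simp, IsWeaklyRegular.nil _ _⟩
  | succ n ih =>
    intro M _ _ _ hM x hx hxr
    obtain ⟨rs, hlen, hmem, hreg⟩ := hM
    match rs, hlen, hmem, hreg with
    | y :: y2 :: rs, hlen, hmem, hreg =>
    rw [isWeaklyRegular_cons_iff] at hreg
    have hymem : y ∈ maximalIdeal R := hmem y (by simp)
    have hy2mem : y2 ∈ maximalIdeal R := hmem y2 (by simp)
    have hy2 := ((isWeaklyRegular_cons_iff _ _ _).1 hreg.2).1
    have hsy : ∀ v : QuotSMulTop y M, (∀ r ∈ maximalIdeal R, r • v = 0) → v = 0 := by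
      intro v hv
      apply hy2
      simpa using hv y2 hy2mem
    have hsx := socle_transfer (maximalIdeal R) hymem hxr hreg.1 hsy
    obtain ⟨z, hz, hzr⟩ := exists_regular (R := R) (QuotSMulTop x M × QuotSMulTop y M) (by
      rintro ⟨a, b⟩ hab
      rw [Prod.mk_eq_zero]
      exact ⟨hsx a fun r hr => (Prod.mk_eq_zero.1 (hab r hr)).1,
        hsy b fun r hr => (Prod.mk_eq_zero.1 (hab r hr)).2⟩)
    have hzx : IsSMulRegular (QuotSMulTop x M) z := by
      intro a b hab
      have := @hzr (a, 0) (b, 0) (by simpa using hab)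
      exact (Prod.ext_iff.1 this).1
    have hzy : IsSMulRegular (QuotSMulTop y M) z := by
      intro a b hab
      have := @hzr (0, a) (0, b) (by simpa using hab)
      exact (Prod.ext_iff.1 this).2
    have hnoeth : IsNoetherian R M := inferInstance
    -- pass to `M / (y, z)`
    obtain ⟨ts, htl, htm, htr⟩ := ih (QuotSMulTop y M)
      ⟨y2 :: rs, by simpa using hlen, fun r hr => hmem r (by simp at hr ⊢; tauto), hreg.2⟩ z hz hzy
    have h1 : IsWeaklyRegular M (y :: z :: ts) := by
      rw [isWeaklyRegular_cons_iff, isWeaklyRegular_cons_iff]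
      exact ⟨hreg.1, hzy, htr⟩
    have h2 : IsWeaklyRegular M (z :: y :: ts) :=
      isWeaklyRegular_of_perm_of_subset_maximalIdeal h1 (List.Perm.swap _ _ _) (by
        intro r hr
        simp only [List.mem_cons] at hr
        rcases hr with rfl | rfl | hr
        exacts [hymem, hz, htm r hr])
    rw [isWeaklyRegular_cons_iff] at h2
    have h3 : IsWeaklyRegular M [x, z] := by
      rw [isWeaklyRegular_cons_iff, isWeaklyRegular_singleton_iff]
      exact ⟨hxr, hzx⟩
    have h4 : IsWeaklyRegular M [z, x] :=
      isWeaklyRegular_of_perm_of_subset_maximalIdeal h3 (List.Perm.swap _ _ _) (by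
        intro r hr
        simp only [List.mem_cons, List.not_mem_nil, or_false] at hr
        rcases hr with rfl | rfl
        exacts [hx, hz])
    rw [isWeaklyRegular_cons_iff, isWeaklyRegular_singleton_iff] at h4
    obtain ⟨us, hul, hum, hur⟩ := ih (QuotSMulTop z M)
      ⟨y :: ts, by simp [htl], by
        intro r hr
        simp only [List.mem_cons] at hr
        rcases hr with rfl | hr
        exacts [hymem, htm r hr], h2.2⟩ x hx h4.2
    have h5 : IsWeaklyRegular M (z :: x :: us) := by
      rw [isWeaklyRegular_cons_iff, isWeaklyRegular_cons_iff]
      exact ⟨h4.1, h4.2, hur⟩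
    have h6 : IsWeaklyRegular M (x :: z :: us) :=
      isWeaklyRegular_of_perm_of_subset_maximalIdeal h5 (List.Perm.swap _ _ _) (by
        intro r hr
        simp only [List.mem_cons] at hr
        rcases hr with rfl | rfl | hr
        exacts [hz, hx, hum r hr])
    rw [isWeaklyRegular_cons_iff] at h6
    refine ⟨z :: us, by simp [hul], ?_, h6.2⟩
    intro r hr
    simp only [List.mem_cons] at hr
    rcases hr with rfl | hr
    exacts [hz, hum r hr]

lemma exists_assoc_quot {M : Type v} [AddCommGroup M] [Module R M] [Module.Finite R M]
    {p : Ideal R} (hp : IsAssociatedPrime p M) {x : R} (hx : x ∈ maximalIdeal R)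
    (hxr : IsSMulRegular M x) :
    ∃ q : Ideal R, IsAssociatedPrime q (QuotSMulTop x M) ∧ p ≤ q ∧ x ∈ q := by
  obtain ⟨hpp, v, hv⟩ := isAssociatedPrime_iff.1 hp
  -- the submodule killed by `p`
  let N : Submodule R M := Submodule.torsionBySet R M (p : Set R)
  have hN : ∀ u, u ∈ N ↔ ∀ r ∈ p, r • u = 0 := by
    intro u
    simp [N, Submodule.mem_torsionBySet_iff]
  have hvN : v ∈ N := by
    rw [hN]
    intro r hr
    rw [hv] at hr
    simpa [Submodule.mem_colon] using hr
  have hv0 : v ≠ 0 := by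
    rintro rfl
    exact hpp.ne_top (by rw [hv]; simp)
  obtain ⟨u, huN, hu⟩ : ∃ u ∈ N, (Submodule.Quotient.mk u : QuotSMulTop x M) ≠ 0 := by
    by_contra! hc
    have hle : N ≤ maximalIdeal R • N := by
      intro u hu
      obtain ⟨w, rfl⟩ := (mk_eq_zero_iff x u).1 (hc u hu)
      refine Submodule.smul_mem_smul hx ?_
      rw [hN] at hu ⊢
      intro r hr
      apply hxr
      change x • r • w = x • 0
      rw [smul_comm, hu r hr, smul_zero]
    have hbot : N = ⊥ := Submodule.eq_bot_of_le_smul_of_le_jacobson_bot (maximalIdeal R) N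
      (IsNoetherian.noetherian N) hle (maximalIdeal_le_jacobson _)
    exact hv0 (by simpa [hbot] using hvN)
  obtain ⟨q, hq, hqle⟩ := exists_le_isAssociatedPrime_of_isNoetherianRing R _ hu
  refine ⟨q, hq, fun r hr => hqle ?_, hqle ?_⟩
  · simp only [Submodule.mem_colon_singleton, Submodule.mem_bot]
    rw [← Submodule.Quotient.mk_smul, (hN u).1 huN r hr, Submodule.Quotient.mk_zero]
  · simp only [Submodule.mem_colon_singleton, Submodule.mem_bot]
    rw [← Submodule.Quotient.mk_smul, mk_eq_zero_iff]
    exact ⟨u, rfl⟩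

lemma le_dim (n : ℕ) : ∀ (M : Type v) [AddCommGroup M] [Module R M] [Module.Finite R M]
    (_ : HasSeq R n M) (p : Ideal R) (_ : IsAssociatedPrime p M),
    (n : WithBot ℕ∞) ≤ ringKrullDim (R ⧸ p) := by
  induction n with
  | zero =>
    intro M _ _ _ _ p hp
    have := hp.1
    simpa using ringKrullDim_nonneg_of_nontrivial
  | succ n ih =>
    intro M _ _ _ hM p hp
    obtain ⟨rs, hlen, hmem, hreg⟩ := hM
    match rs, hlen, hmem, hreg with
    | x :: rs, hlen, hmem, hreg =>
    rw [isWeaklyRegular_cons_iff] at hreg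
    obtain ⟨q, hq, hpq, hxq⟩ := exists_assoc_quot hp (hmem x (by simp)) hreg.1
    have h1 := ih (QuotSMulTop x M)
      ⟨rs, by simpa using hlen, fun r hr => hmem r (by simp [hr]), hreg.2⟩ q hq
    have hprime := hp.1
    have hxp : x ∉ p := by
      intro hxp
      have : x ∈ ⋃ p ∈ associatedPrimes R M, (p : Set R) := by
        simp only [Set.mem_iUnion]
        exact ⟨p, hp, hxp⟩
      rw [biUnion_associatedPrimes_eq_compl_regular] at this
      exact this hreg.1
    have h2 : ringKrullDim ((R ⧸ p) ⧸ Ideal.span {Ideal.Quotient.mk p x}) + 1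
        ≤ ringKrullDim (R ⧸ p) := by
      apply ringKrullDim_quotient_succ_le_of_nonZeroDivisor
      rw [mem_nonZeroDivisors_iff_ne_zero]
      rwa [Ne, Ideal.Quotient.eq_zero_iff_mem]
    have h3 : ringKrullDim (R ⧸ q) ≤ 
        ringKrullDim ((R ⧸ p) ⧸ Ideal.span {Ideal.Quotient.mk p x}) := by
      refine ringKrullDim_le_of_surjective
        (Ideal.Quotient.lift (Ideal.span {Ideal.Quotient.mk p x})
          (Ideal.Quotient.factor hpq) ?_) ?_
      · intro a ha
        obtain ⟨b, rfl⟩ := Ideal.mem_span_singleton'.1 ha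
        rw [map_mul, Ideal.Quotient.factor_mk, Ideal.Quotient.eq_zero_iff_mem.2 hxq, mul_zero]
      · apply Ideal.Quotient.lift_surjective_of_surjective
        exact Ideal.Quotient.factor_surjective hpq
    push_cast
    exact (add_le_add_left (h1.trans h3) 1).trans h2

theorem local_regular : ∀ (fs : List R) (M : Type v) [AddCommGroup M] [Module R M]
    [Module.Finite R M] (_ : HasSeq R fs.length M) (_ : ∀ r ∈ fs, r ∈ maximalIdeal R)
    (_ : maximalIdeal R ≤ (Module.annihilator R M ⊔ Ideal.ofList fs).radical),
    IsWeaklyRegular M fs := by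
  intro fs
  induction fs with
  | nil => intro M _ _ _ _ _ _; exact IsWeaklyRegular.nil _ _
  | cons f fs ih =>
    intro M _ _ _ hM hmem hrad
    have hfm : f ∈ maximalIdeal R := hmem f (by simp)
    have hreg : IsSMulRegular M f := by
      by_contra hc
      have : f ∈ ⋃ p ∈ associatedPrimes R M, (p : Set R) := by
        rw [biUnion_associatedPrimes_eq_compl_regular]; exact hc
      simp only [Set.mem_iUnion] at this
      obtain ⟨p, hp, hfp⟩ := this
      have hdim := le_dim _ M hM p hp
      have hprime := hp.1
      have hloc : IsLocalRing (R ⧸ p) :=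
        IsLocalRing.of_surjective' (Ideal.Quotient.mk p) Ideal.Quotient.mk_surjective
      have hann : Module.annihilator R M ≤ p := by
        rw [← Submodule.annihilator_top]; exact hp.annihilator_le
      rw [← maximalIdeal_height_eq_ringKrullDim] at hdim
      have hmin : maximalIdeal (R ⧸ p) ∈
          (Ideal.span {a | a ∈ fs.map (Ideal.Quotient.mk p)}).minimalPrimes := by
        refine ⟨⟨inferInstance, ?_⟩, ?_⟩
        · rw [Ideal.span_le]
          intro a ha
          simp only [List.mem_map, Set.mem_ofPred_eq] at ha
          obtain ⟨b, hb, rfl⟩ := ha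
          have hb' := hmem b (by simp [hb])
          rw [SetLike.mem_coe, mem_maximalIdeal, mem_nonunits_iff] at *
          intro hu
          have : IsLocalHom (Ideal.Quotient.mk p) :=
            Function.Surjective.isLocalHom _ Ideal.Quotient.mk_surjective
          exact hb' ((isUnit_map_iff (Ideal.Quotient.mk p) b).1 hu)
        · rintro Q ⟨hQ, hQle⟩ -
          have hle : (Module.annihilator R M ⊔ Ideal.ofList (f :: fs)) ≤
              Q.comap (Ideal.Quotient.mk p) := by
            have hpc : p ≤ Q.comap (Ideal.Quotient.mk p) := by
              intro a ha
              rw [Ideal.mem_comap, Ideal.Quotient.eq_zero_iff_mem.2 ha]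
              exact zero_mem _
            refine sup_le (hann.trans hpc) (Ideal.span_le.2 ?_)
            intro a ha
            simp only [Set.mem_ofPred_eq, List.mem_cons] at ha
            rcases ha with rfl | ha
            · exact hpc hfp
            · exact hQle (Ideal.subset_span (List.mem_map_of_mem ha))
          have hle2 := hrad.trans ((hQ.comap (Ideal.Quotient.mk p)).radical_le_iff.2 hle)
          intro a ha
          obtain ⟨b, rfl⟩ := Ideal.Quotient.mk_surjective a
          apply hle2
          rw [mem_maximalIdeal, mem_nonunits_iff] at *
          exact fun hu => ha (hu.map _)
      have hfin : Set.Finite {a | a ∈ fs.map (Ideal.Quotient.mk p)} := List.finite_toSet _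
      have hht := Ideal.height_le_card_of_mem_minimalPrimes_span hfin hmin
      have hcard : Set.ncard {a | a ∈ fs.map (Ideal.Quotient.mk p)} ≤ fs.length := by
        classical
        have : {a | a ∈ fs.map (Ideal.Quotient.mk p)} =
          ((fs.map (Ideal.Quotient.mk p)).toFinset : Set (R ⧸ p)) := by ext; simp
        rw [this, Set.ncard_coe_finset]
        exact (List.toFinset_card_le _).trans (by simp)
      have h1 : ((f :: fs).length : ℕ∞) ≤ (maximalIdeal (R ⧸ p)).height := by exact_mod_cast hdim
      have h2 := (h1.trans hht).trans (Nat.cast_le.2 hcard)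
      simp only [List.length_cons, Nat.cast_le] at h2
      omega
    refine IsWeaklyRegular.cons hreg (ih _ ?_ (fun r hr => hmem r (by simp [hr])) ?_)
    · exact hasSeq_quot _ M hM f hfm hreg
    · refine hrad.trans (Ideal.radical_mono ?_)
      rw [Ideal.ofList_cons, ← sup_assoc]
      refine sup_le_sup_right (sup_le ?_ ?_) _
      · intro a ha
        rw [Module.mem_annihilator] at ha ⊢
        intro m
        obtain ⟨m, rfl⟩ := Submodule.Quotient.mk_surjective _ m
        rw [← Submodule.Quotient.mk_smul, ha, Submodule.Quotient.mk_zero]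
      · rw [Ideal.span_singleton_le_iff_mem, Module.mem_annihilator]
        intro m
        obtain ⟨m, rfl⟩ := Submodule.Quotient.mk_surjective _ m
        rw [← Submodule.Quotient.mk_smul, mk_eq_zero_iff]
        exact ⟨m, rfl⟩


lemma wr_iff {S : Type u} [CommRing S] (rs : List S) : IsWeaklyRegular S rs ↔
    ∀ i (hi : i < rs.length), ∀ h, rs[i] * h ∈ Ideal.ofList (rs.take i) →
      h ∈ Ideal.ofList (rs.take i) := by
  rw [isWeaklyRegular_iff]
  refine forall_congr' fun i => forall_congr' fun hi => ?_
  rw [isSMulRegular_iff_right_eq_zero_of_smul]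
  constructor
  · intro H h hh
    have := H (Submodule.Quotient.mk h) (by
      rw [← Submodule.Quotient.mk_smul, Submodule.Quotient.mk_eq_zero]
      simpa using hh)
    rw [Submodule.Quotient.mk_eq_zero] at this
    simpa using this
  · intro H h hh
    obtain ⟨h, rfl⟩ := Submodule.Quotient.mk_surjective _ h
    rw [← Submodule.Quotient.mk_smul, Submodule.Quotient.mk_eq_zero] at hh
    rw [Submodule.Quotient.mk_eq_zero]
    have := H h (by simpa using hh)
    simpa using this

lemma X_regular (N : ℕ) :
    IsWeaklyRegular (MvPolynomial (Fin N) ℂ) (List.ofFn (X : Fin N → MvPolynomial (Fin N) ℂ)) := by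
  rw [wr_iff]
  intro i hi h hh
  have hiN : i < N := by simpa using hi
  have hset : Ideal.ofList ((List.ofFn (X : Fin N → MvPolynomial (Fin N) ℂ)).take i) =
      Ideal.span (X '' {j : Fin N | (j : ℕ) < i}) := by
    unfold Ideal.ofList
    congr 1
    ext a
    simp only [Set.mem_ofPred_eq, List.mem_take_iff_getElem, Set.mem_image]
    constructor
    · rintro ⟨j, hj, rfl⟩
      simp only [List.length_ofFn, lt_min_iff] at hj
      exact ⟨⟨j, hj.2⟩, hj.1, by simp⟩
    · rintro ⟨j, hj, rfl⟩
      exact ⟨j, by simp [hj], by simp⟩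
  rw [hset, mem_ideal_span_X_image] at hh ⊢
  intro m hm
  rw [List.getElem_ofFn] at hh
  obtain ⟨j, hj, hne⟩ := hh (m + Finsupp.single ⟨i, hiN⟩ 1) (by
    rw [mem_support_iff, mul_comm, coeff_mul_X]
    exact mem_support_iff.1 hm)
  refine ⟨j, hj, ?_⟩
  have hji : (⟨i, hiN⟩ : Fin N) ≠ j := by
    rintro rfl
    simp at hj
  simpa [Finsupp.single_apply, hji] using hne

attribute [local instance] MvPolynomial.gradedAlgebra

lemma mem_of_mul_mem {N : ℕ} {I : Ideal (MvPolynomial (Fin N) ℂ)}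
    (hI : I.IsHomogeneous (homogeneousSubmodule (Fin N) ℂ)) {s h : MvPolynomial (Fin N) ℂ}
    (hs : constantCoeff s ≠ 0) (hsh : s * h ∈ I) : h ∈ I := by
  let t : MvPolynomial (Fin N) ℂ := 1 - C (constantCoeff s)⁻¹ * s
  have ht : t ∈ idealOfVars (Fin N) ℂ := by
    rw [← pow_one (idealOfVars (Fin N) ℂ), mem_pow_idealOfVars_iff']
    intro x hx
    have : x = 0 := (Finsupp.degree_eq_zero_iff x).1 (Nat.lt_one_iff.1 hx)
    subst this
    rw [← constantCoeff_eq]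
    simp [t, hs]
  have h1 : h - t * h ∈ I := by
    have : h - t * h = C (constantCoeff s)⁻¹ * (s * h) := by simp only [t]; ring
    rw [this]
    exact I.mul_mem_left _ hsh
  have h2 : ∀ k, h - t ^ k * h ∈ I := by
    intro k
    induction k with
    | zero => simp
    | succ k ih =>
      have : h - t ^ (k + 1) * h = (h - t ^ k * h) + t ^ k * (h - t * h) := by ring
      rw [this]
      exact I.add_mem ih (I.mul_mem_left _ h1)
  rw [mem_iff_homogeneousComponent_mem hI]
  intro d
  have h3 := homogeneousComponent_mem_of_mem hI (h2 (d + 1)) d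
  have h4 : homogeneousComponent d (t ^ (d + 1) * h) = 0 := by
    ext m
    rw [coeff_homogeneousComponent]
    split_ifs with hm
    · have : t ^ (d + 1) * h ∈ idealOfVars (Fin N) ℂ ^ (d + 1) :=
        Ideal.mul_mem_right _ _ (Ideal.pow_mem_pow ht _)
      rw [mem_pow_idealOfVars_iff'] at this
      rw [this m (by omega)]
      simp
    · simp
  rw [map_sub, h4, sub_zero] at h3
  exact h3

theorem main (N : ℕ) (f : Fin N → MvPolynomial (Fin N) ℂ) (e : Fin N → ℕ)
    (he : ∀ i, 0 < e i) (hf : ∀ i, (f i).IsHomogeneous (e i))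
    (hz : ∀ x : Fin N → ℂ, (∀ i, eval x (f i) = 0) → x = 0) :
    IsRegular (MvPolynomial (Fin N) ℂ) (List.ofFn f) := by
  let m : Ideal (MvPolynomial (Fin N) ℂ) := RingHom.ker constantCoeff
  have hm : m.IsPrime := RingHom.ker_isPrime _
  let A := Localization.AtPrime m
  have hfm : ∀ i, f i ∈ m := by
    intro i
    rw [RingHom.mem_ker, constantCoeff_eq]
    apply (hf i).coeff_eq_zero
    simpa using (he i).ne
  have hXm : ∀ i, (X i : MvPolynomial (Fin N) ℂ) ∈ m := by
    intro i
    rw [RingHom.mem_ker]; simp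
  have hmvars : m ≤ idealOfVars (Fin N) ℂ := by
    intro p hp
    rw [← pow_one (idealOfVars (Fin N) ℂ), mem_pow_idealOfVars_iff']
    intro x hx
    have : x = 0 := (Finsupp.degree_eq_zero_iff x).1 (Nat.lt_one_iff.1 hx)
    subst this
    rwa [RingHom.mem_ker, constantCoeff_eq] at hp
  have hlist : ∀ (g : Fin N → MvPolynomial (Fin N) ℂ), (∀ i, g i ∈ m) →
      ∀ r ∈ (List.ofFn g).map (algebraMap _ A), r ∈ maximalIdeal A := by
    intro g hg r hr
    simp only [List.mem_map, List.mem_ofFn] at hr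
    obtain ⟨_, ⟨i, rfl⟩, rfl⟩ := hr
    exact (IsLocalization.AtPrime.to_map_mem_maximal_iff A m _).2 (hg i)
  have hnoeth : IsNoetherianRing A := IsLocalization.isNoetherianRing m.primeCompl A inferInstance
  -- Nullstellensatz
  have hrad : m ≤ (Ideal.ofList (List.ofFn f)).radical := by
    refine hmvars.trans (Ideal.span_le.2 ?_)
    rintro _ ⟨i, rfl⟩
    rw [SetLike.mem_coe, ← vanishingIdeal_zeroLocus_eq_radical (K := ℂ), mem_vanishingIdeal_iff]
    intro x hx
    have : x = 0 := hz x fun j => by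
      have := hx (f j) (Ideal.subset_span (by simp))
      simpa [aeval_eq_eval] using this
    simp [this]
  have hloc : IsWeaklyRegular A ((List.ofFn f).map (algebraMap _ A)) := by
    apply local_regular
    · exact ⟨(List.ofFn X).map (algebraMap _ A), by simp, hlist X hXm,
        (X_regular N).of_isLocalization A m.primeCompl⟩
    · exact hlist f hfm
    · rw [← Localization.AtPrime.map_eq_maximalIdeal, ← Ideal.map_ofList]
      refine (Ideal.map_mono hrad).trans ((Ideal.map_radical_le _).trans
        (Ideal.radical_mono le_sup_right))
  refine ⟨?_, ?_⟩
  · rw [wr_iff] at hloc ⊢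
    intro i hi h hh
    have hhom : (Ideal.ofList ((List.ofFn f).take i)).IsHomogeneous
        (homogeneousSubmodule (Fin N) ℂ) := by
      apply Ideal.homogeneous_span
      intro a ha
      have ha' := List.mem_of_mem_take ha
      rw [List.mem_ofFn] at ha'
      obtain ⟨j, rfl⟩ := ha'
      exact ⟨e j, hf j⟩
    have h1 := hloc i (by simpa using hi) (algebraMap _ A h) (by
      rw [List.getElem_map, ← map_mul, ← List.map_take, ← Ideal.map_ofList]
      exact Ideal.mem_map_of_mem _ hh)
    rw [← List.map_take, ← Ideal.map_ofList,
      IsLocalization.algebraMap_mem_map_algebraMap_iff m.primeCompl] at h1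
    obtain ⟨s, hs, hsh⟩ := h1
    exact mem_of_mul_mem hhom (s := s) (fun h0 => hs h0) hsh
  · intro htop
    have hle : Ideal.ofList (List.ofFn f) ≤ m := by
      refine Ideal.span_le.2 ?_
      intro a ha
      simp only [Set.mem_ofPred_eq, List.mem_ofFn] at ha
      obtain ⟨j, rfl⟩ := ha
      exact hfm j
    apply hm.ne_top
    rw [eq_top_iff, htop]
    simpa using hle

end HomReg

/-- Homogeneous polynomials `f_1,…,f_N` of positive degrees in `N` variables whose only common
zero in `ℂ^N` is the origin form a regular sequence in `ℂ[x_1,…,x_N]`. -/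
theorem homogeneous_with_only_zero_common_root_isRegular
    (N : ℕ) (hN : 1 ≤ N) (f : Fin N → MvPolynomial (Fin N) ℂ) (e : Fin N → ℕ)
    (he : ∀ i, 0 < e i) (hf : ∀ i, (f i).IsHomogeneous (e i))
    (hz : ∀ x : Fin N → ℂ, (∀ i, eval x (f i) = 0) → x = 0) :
    RingTheory.Sequence.IsRegular (MvPolynomial (Fin N) ℂ) (List.ofFn f) :=
  HomReg.main N f e he hf hz
end
end

section
/- (Hilbert series of an Artinian complete intersection.) Let N ≥ 1 and let f_1,…,f_N ∈ S = ℂ[x_1,…,x_N] be homogeneous polynomials of degrees e_1,…,e_N ≥ 1 forming a regular sequence, and let R = S ⧸ (f_1,…,f_N). Then for every k ∈ ℕ, dim_ℂ R_k equals the coefficient of t^k in the polynomial ∏_{i=1}^N (1 + t + ⋯ + t^{e_i−1}). -/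
noncomputable section

open MvPolynomial

attribute [local instance] MvPolynomial.gradedAlgebra

lemma aux_comp_mul {N : ℕ} {f : MvPolynomial (Fin N) ℂ} {e : ℕ} (hf : f.IsHomogeneous e)
    (b : MvPolynomial (Fin N) ℂ) (k : ℕ) :
    homogeneousComponent k (f * b) =
      if e ≤ k then f * homogeneousComponent (k - e) b else 0 := by
  have key : ∀ i, homogeneousComponent k (f * homogeneousComponent i b) =
      if k = e + i then f * homogeneousComponent i b else 0 := by
    intro i
    rw [homogeneousComponent_of_mem (m := k) (n := e + i)]
    exact hf.mul (homogeneousComponent_isHomogeneous i b)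
  have hb : f * b = ∑ i ∈ Finset.range (b.totalDegree + 1), f * homogeneousComponent i b := by
    rw [← Finset.mul_sum, sum_homogeneousComponent]
  rw [hb, map_sum, Finset.sum_congr rfl (fun i _ => key i)]
  split_ifs with h
  · have : ∀ i, (k = e + i) ↔ (k - e = i) := by intro i; omega
    simp only [this, Finset.sum_ite_eq, Finset.mem_range]
    split_ifs with h2
    · rfl
    · rw [homogeneousComponent_eq_zero _ _ (by omega), mul_zero]
  · refine Finset.sum_eq_zero fun i _ => ?_
    rw [if_neg (by omega)]

instance aux_fin {N : ℕ} (I : Ideal (MvPolynomial (Fin N) ℂ)) (k : ℕ) :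
    Module.Finite ℂ (gradedPiece I k) :=
  Module.Finite.iff_fg.mpr ((homogeneousSubmodule_fg (Fin N) ℂ k).map _)

lemma aux_mem {N : ℕ} (I : Ideal (MvPolynomial (Fin N) ℂ)) (k : ℕ) (x) :
    x ∈ gradedPiece I k ↔ ∃ p : MvPolynomial (Fin N) ℂ, p.IsHomogeneous k ∧
      Ideal.Quotient.mk I p = x := Iff.rfl

lemma aux_step {N : ℕ} (I : Ideal (MvPolynomial (Fin N) ℂ))
    (hI : I.IsHomogeneous (homogeneousSubmodule (Fin N) ℂ))
    {f : MvPolynomial (Fin N) ℂ} {e : ℕ} (hf : f.IsHomogeneous e)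
    (hreg : ∀ x, f * x ∈ I → x ∈ I) (k : ℕ) :
    Module.finrank ℂ (gradedPiece (I ⊔ Ideal.span {f}) k) +
      (if e ≤ k then Module.finrank ℂ (gradedPiece I (k - e)) else 0) =
      Module.finrank ℂ (gradedPiece I k) := by
  set J := I ⊔ Ideal.span {f} with hJ
  let g : (MvPolynomial (Fin N) ℂ ⧸ I) →ₗ[ℂ] (MvPolynomial (Fin N) ℂ ⧸ J) :=
    (Ideal.Quotient.factorₐ ℂ (le_sup_left : I ≤ J)).toLinearMap
  have hg : ∀ p, g (Ideal.Quotient.mk I p) = Ideal.Quotient.mk J p := fun p => rfl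
  have h := LinearMap.finrank_range_add_finrank_ker (g.domRestrict (gradedPiece I k))
  have h1 : LinearMap.range (g.domRestrict (gradedPiece I k)) = gradedPiece J k := by
    ext x
    rw [aux_mem]
    constructor
    · rintro ⟨⟨y, hy⟩, rfl⟩
      obtain ⟨p, hp, rfl⟩ := (aux_mem _ _ _).1 hy
      exact ⟨p, hp, rfl⟩
    · rintro ⟨p, hp, rfl⟩
      exact ⟨⟨Ideal.Quotient.mk I p, (aux_mem _ _ _).2 ⟨p, hp, rfl⟩⟩, rfl⟩
  have h2 : Module.finrank ℂ (LinearMap.ker (g.domRestrict (gradedPiece I k))) =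
      if e ≤ k then Module.finrank ℂ (gradedPiece I (k - e)) else 0 := by
    rw [← Submodule.finrank_map_subtype_eq]
    have hmem : ∀ x, x ∈ (LinearMap.ker (g.domRestrict (gradedPiece I k))).map
        (gradedPiece I k).subtype ↔ x ∈ gradedPiece I k ∧ g x = 0 := by
      intro x
      constructor
      · rintro ⟨⟨y, hy⟩, hy2, rfl⟩
        exact ⟨hy, hy2⟩
      · rintro ⟨hy, hy2⟩
        exact ⟨⟨x, hy⟩, hy2, rfl⟩
    have hdec : ∀ p : MvPolynomial (Fin N) ℂ, p.IsHomogeneous k → p ∈ J →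
        ∃ a ∈ I, ∃ b, p = a + homogeneousComponent k (f * b) := by
      intro p hp hpJ
      obtain ⟨a, ha, c, hc, rfl⟩ := Submodule.mem_sup.1 hpJ
      obtain ⟨b, rfl⟩ := Ideal.mem_span_singleton'.1 hc
      refine ⟨homogeneousComponent k a, homogeneousComponent_mem_of_mem hI ha k, b, ?_⟩
      rw [mul_comm f b, ← map_add, homogeneousComponent_eq_self hp]
    split_ifs with hk
    · have hinj : Function.Injective (mulMap I f) := by
        rw [injective_iff_map_eq_zero]
        intro x hx
        obtain ⟨x, rfl⟩ := Ideal.Quotient.mk_surjective x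
        have hx' : Ideal.Quotient.mk I (f * x) = 0 := by
          rw [map_mul]; exact hx
        exact Ideal.Quotient.eq_zero_iff_mem.2 (hreg x (Ideal.Quotient.eq_zero_iff_mem.1 hx'))
      rw [(Submodule.equivMapOfInjective _ hinj (gradedPiece I (k - e))).finrank_eq]
      suffices hs : (LinearMap.ker (g.domRestrict (gradedPiece I k))).map
          (gradedPiece I k).subtype = (gradedPiece I (k - e)).map (mulMap I f) by rw [hs]
      ext x
      rw [hmem]
      constructor
      · rintro ⟨hx, hx0⟩
        obtain ⟨p, hp, rfl⟩ := (aux_mem _ _ _).1 hx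
        rw [hg, Ideal.Quotient.eq_zero_iff_mem] at hx0
        obtain ⟨a, ha, b, hab⟩ := hdec p hp hx0
        rw [aux_comp_mul hf, if_pos hk] at hab
        refine ⟨Ideal.Quotient.mk I (homogeneousComponent (k - e) b),
          ⟨_, homogeneousComponent_isHomogeneous _ _, rfl⟩, ?_⟩
        rw [hab, map_add, Ideal.Quotient.eq_zero_iff_mem.2 ha, zero_add, map_mul]
        rfl
      · rintro ⟨y, hy, rfl⟩
        obtain ⟨p, hp, rfl⟩ := (aux_mem _ _ _).1 hy
        have he : mulMap I f (Ideal.Quotient.mk I p) = Ideal.Quotient.mk I (f * p) := by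
          rw [map_mul]; rfl
        rw [he, hg, Ideal.Quotient.eq_zero_iff_mem]
        refine ⟨⟨f * p, ?_, rfl⟩, ?_⟩
        · have := hf.mul hp
          rwa [Nat.add_sub_cancel' hk] at this
        · exact Ideal.mul_mem_right _ _
            ((le_sup_right : _ ≤ J) (Ideal.mem_span_singleton_self f))
    · rw [show (LinearMap.ker (g.domRestrict (gradedPiece I k))).map
        (gradedPiece I k).subtype = ⊥ from ?_, finrank_bot]
      rw [eq_bot_iff]
      intro x hx
      rw [hmem] at hx
      obtain ⟨hx, hx0⟩ := hx
      obtain ⟨p, hp, rfl⟩ := (aux_mem _ _ _).1 hx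
      rw [hg, Ideal.Quotient.eq_zero_iff_mem] at hx0
      obtain ⟨a, ha, b, hab⟩ := hdec p hp hx0
      rw [aux_comp_mul hf, if_neg hk, add_zero] at hab
      rw [hab, Ideal.Quotient.eq_zero_iff_mem.2 ha]
      exact zero_mem _
  rw [h1, h2] at h
  exact h

/-- The Hilbert series. -/
def auxH {N : ℕ} (I : Ideal (MvPolynomial (Fin N) ℂ)) : PowerSeries ℤ :=
  PowerSeries.mk fun k => (Module.finrank ℂ (gradedPiece I k) : ℤ)

lemma auxH_step {N : ℕ} (I : Ideal (MvPolynomial (Fin N) ℂ))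
    (hI : I.IsHomogeneous (homogeneousSubmodule (Fin N) ℂ))
    {f : MvPolynomial (Fin N) ℂ} {e : ℕ} (hf : f.IsHomogeneous e)
    (hreg : ∀ x, f * x ∈ I → x ∈ I) :
    auxH (I ⊔ Ideal.span {f}) = auxH I * (1 - PowerSeries.X ^ e) := by
  ext k
  rw [mul_sub, mul_one, map_sub, PowerSeries.coeff_mul_X_pow']
  simp only [auxH, PowerSeries.coeff_mk]
  rw [← aux_step I hI hf hreg k]
  split_ifs <;> simp

lemma auxH_bot {N : ℕ} (hN : 1 ≤ N) :
    auxH (⊥ : Ideal (MvPolynomial (Fin N) ℂ)) * (1 - PowerSeries.X) ^ N = 1 := by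
  obtain ⟨d, rfl⟩ : ∃ d, N = d + 1 := ⟨N - 1, by omega⟩
  refine Eq.trans ?_ (PowerSeries.mk_add_choose_mul_one_sub_pow_eq_one ℤ d)
  congr 1
  ext k
  simp only [auxH, PowerSeries.coeff_mk]
  norm_cast
  have hinj : Function.Injective (Ideal.Quotient.mkₐ ℂ
      (⊥ : Ideal (MvPolynomial (Fin (d+1)) ℂ))).toLinearMap := by
    rw [injective_iff_map_eq_zero]
    intro x hx
    exact Ideal.mem_bot.1 (Ideal.Quotient.eq_zero_iff_mem.1 hx)
  have h1 := (Submodule.equivMapOfInjective _ hinj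
    (homogeneousSubmodule (Fin (d+1)) ℂ k)).finrank_eq
  rw [gradedPiece, ← h1, homogeneousSubmodule_eq_finsupp_supported]
  have h2 : {x : Fin (d+1) →₀ ℕ | x.degree = k} =
      ((Finset.univ : Finset (Fin (d+1))).finsuppAntidiag k : Set _) := by
    ext x
    simp [Finset.mem_finsuppAntidiag, Finsupp.degree_eq_sum]
  rw [h2]
  have h3 := (AddMonoidAlgebra.supportedEquivFinsupp (R := ℂ) (S := ℂ)
    ((Finset.univ : Finset (Fin (d+1))).finsuppAntidiag k : Set (Fin (d+1) →₀ ℕ))).finrank_eq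
  refine h3.trans ?_
  rw [Module.finrank_finsupp_self]
  simp only [Finset.coe_sort_coe, Fintype.card_coe]
  rw [Finset.card_finsuppAntidiag_nat_eq_choose]
  simp only [Finset.card_univ, Fintype.card_fin]
  rw [show d + 1 + k - 1 = d + k by omega]
  exact (Nat.choose_symm_add).symm

lemma auxH_take {N : ℕ} (f : Fin N → MvPolynomial (Fin N) ℂ) (e : Fin N → ℕ)
    (hf : ∀ i, (f i).IsHomogeneous (e i))
    (hreg : RingTheory.Sequence.IsRegular (MvPolynomial (Fin N) ℂ) (List.ofFn f)) (n : ℕ)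
    (hn : n ≤ N) :
    auxH (Ideal.ofList ((List.ofFn f).take n)) =
      auxH (⊥ : Ideal (MvPolynomial (Fin N) ℂ)) * ∏ i : Fin n, (1 - PowerSeries.X ^ e (Fin.castLE hn i)) := by
  induction n with
  | zero => simp
  | succ n ih =>
    have hl : n < (List.ofFn f).length := by simpa using hn
    rw [Fin.prod_univ_castSucc, ← mul_assoc]
    have h := ih (by omega)
    simp only [Fin.castLE_castSucc]
    rw [← h, List.take_succ_eq_append_getElem hl, Ideal.ofList_append, Ideal.ofList_singleton]
    have hget : (List.ofFn f)[n] = f (Fin.castLE hn (Fin.last n)) := by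
      rw [List.getElem_ofFn]; rfl
    have hr := hreg.toIsWeaklyRegular.regular_mod_prev n hl
    rw [isSMulRegular_quotient_iff_mem_of_smul_mem] at hr
    rw [hget] at hr ⊢
    refine auxH_step _ ?_ (hf _) ?_
    · refine Ideal.homogeneous_span _ _ fun x hx => ?_
      obtain ⟨i, rfl⟩ := (List.mem_ofFn' f x).1 (List.mem_of_mem_take hx)
      exact ⟨e i, hf i⟩
    · intro x hx
      simpa using hr x (by simpa using hx)

/-- Hilbert series of an Artinian complete intersection: if `f_1,…,f_N` is a regular sequence of
homogeneous polynomials of degrees `e_1,…,e_N ≥ 1` in `ℂ[x_1,…,x_N]`, then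
`dim_ℂ R_k` is the coefficient of `t^k` in `∏ i (1 + t + ⋯ + t^{e_i - 1})`. -/
theorem hilbert_series_of_artinian_complete_intersection
    (N : ℕ) (hN : 1 ≤ N) (f : Fin N → MvPolynomial (Fin N) ℂ) (e : Fin N → ℕ)
    (he : ∀ i, 1 ≤ e i) (hf : ∀ i, (f i).IsHomogeneous (e i))
    (hreg : RingTheory.Sequence.IsRegular (MvPolynomial (Fin N) ℂ) (List.ofFn f))
    (k : ℕ) :
    (Module.finrank ℂ (gradedPiece (Ideal.span (Set.range f)) k) : ℤ)
      = (∏ i : Fin N, ∑ j ∈ Finset.range (e i), (Polynomial.X : Polynomial ℤ) ^ j).coeff k := by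
  have hN' := auxH_take f e hf hreg N le_rfl
  have hl : (List.ofFn f).take N = List.ofFn f := List.take_of_length_le (by simp)
  have hI : Ideal.ofList (List.ofFn f) = Ideal.span (Set.range f) := by
    rw [Ideal.ofList]
    congr 1
    ext x
    simp [List.mem_ofFn']
  rw [hl, hI] at hN'
  have hprod : (∏ i : Fin N, (1 - PowerSeries.X ^ e (Fin.castLE le_rfl i)) : PowerSeries ℤ) =
      ((∏ i : Fin N, ∑ j ∈ Finset.range (e i), (Polynomial.X : Polynomial ℤ) ^ j :
        Polynomial ℤ) : PowerSeries ℤ) * (1 - PowerSeries.X) ^ N := by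
    have : ∀ i : Fin N, (1 - PowerSeries.X ^ e (Fin.castLE le_rfl i) : PowerSeries ℤ) =
        ((∑ j ∈ Finset.range (e i), (Polynomial.X : Polynomial ℤ) ^ j : Polynomial ℤ) :
          PowerSeries ℤ) * (1 - PowerSeries.X) := by
      intro i
      have h := congrArg (Polynomial.coeToPowerSeries.ringHom (R := ℤ))
        (geom_sum_mul_neg (Polynomial.X : Polynomial ℤ) (e i))
      simp only [map_mul, map_sub, map_one, map_pow,
        Polynomial.coeToPowerSeries.ringHom_apply, Polynomial.coe_X] at h
      exact h.symm
    rw [Finset.prod_congr rfl (fun i _ => this i), Finset.prod_mul_distrib]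
    congr 1
    · exact (map_prod (Polynomial.coeToPowerSeries.ringHom (R := ℤ)) _ _).symm
    · simp
  rw [hprod, mul_comm, mul_assoc, mul_comm _ (auxH ⊥), auxH_bot hN, mul_one] at hN'
  have := congrArg (PowerSeries.coeff k) hN'
  rw [Polynomial.coeff_coe] at this
  rw [← this, auxH, PowerSeries.coeff_mk]
end
end

section
/- (Gorenstein duality for Artinian complete intersections.) Let N ≥ 1 and let f_1,…,f_N ∈ S = ℂ[x_1,…,x_N] be homogeneous polynomials of degrees e_1,…,e_N ≥ 1 forming a regular sequence, and let R = S ⧸ (f_1,…,f_N) and σ = ∑_{i=1}^N (e_i − 1). Then for every 0 ≤ k ≤ σ, the multiplication pairing R_k × R_{σ−k} → R_σ is perfect: the induced ℂ-linear map from R_k to Hom_ℂ(R_{σ−k}, R_σ) sending a to (b ↦ ab) is bijective. -/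
noncomputable section

open MvPolynomial

/-- The bilinear multiplication pairing `R_k × R_l → R_m` (where `k + l = m`) induced by
multiplication in the quotient ring. -/
def gradedPairing {N : ℕ} (I : Ideal (MvPolynomial (Fin N) ℂ)) (k l m : ℕ) (h : k + l = m) :
    gradedPiece I k →ₗ[ℂ] gradedPiece I l →ₗ[ℂ] gradedPiece I m :=
  LinearMap.mk₂ ℂ
    (fun a b => ⟨(a : MvPolynomial (Fin N) ℂ ⧸ I) * (b : MvPolynomial (Fin N) ℂ ⧸ I), by
      obtain ⟨p, hp, hpe⟩ := a.2
      obtain ⟨q, hq, hqe⟩ := b.2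
      refine ⟨p * q, ?_, ?_⟩
      · exact h ▸ ((mem_homogeneousSubmodule _ _).mpr
          (((mem_homogeneousSubmodule _ _).mp hp).mul
            ((mem_homogeneousSubmodule _ _).mp hq) : MvPolynomial.IsHomogeneous _ (k + l)))
      · simp only [AlgHom.toLinearMap_apply, map_mul] at hpe hqe ⊢
        rw [hpe, hqe]⟩)
    (fun a a' b => Subtype.ext (by simp [add_mul]))
    (fun c a b => Subtype.ext (by simp [smul_mul_assoc]))
    (fun a b b' => Subtype.ext (by simp [mul_add]))
    (fun c a b => Subtype.ext (by simp [mul_smul_comm]))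


namespace GorAux

variable {N : ℕ}

lemma mem_sup_iff (K : Ideal (MvPolynomial (Fin N) ℂ)) (g p : MvPolynomial (Fin N) ℂ) :
    p ∈ K ⊔ Ideal.span {g} ↔ ∃ w, p - g * w ∈ K := by
  rw [Submodule.mem_sup]
  constructor
  · rintro ⟨k, hk, z, hz, rfl⟩
    obtain ⟨w, rfl⟩ := Ideal.mem_span_singleton'.1 hz
    exact ⟨w, by simpa [mul_comm] using hk⟩
  · rintro ⟨w, hw⟩
    exact ⟨_, hw, g * w, Ideal.mul_mem_right _ _ (Ideal.mem_span_singleton_self g), by ring⟩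

/-- ideals closed under homogeneous components -/
def HomogI (K : Ideal (MvPolynomial (Fin N) ℂ)) : Prop :=
  ∀ p ∈ K, ∀ d, homogeneousComponent d p ∈ K

lemma comp_mul {g v : MvPolynomial (Fin N) ℂ} {e : ℕ} (hg : g.IsHomogeneous e) (d : ℕ) :
    homogeneousComponent (e + d) (g * v) = g * homogeneousComponent d v := by
  let := MvPolynomial.gradedAlgebra (σ := Fin N) (R := ℂ)
  have h := DirectSum.coe_decompose_mul_add_of_left_mem (homogeneousSubmodule (Fin N) ℂ)
    (a := g) (b := v) (i := e) (j := d) hg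
  simp only [← decomposition.decompose'_apply]
  exact h

attribute [local instance] MvPolynomial.gradedAlgebra in
lemma homogI_span (s : Set (MvPolynomial (Fin N) ℂ)) (h : ∀ x ∈ s, ∃ d, x.IsHomogeneous d) :
    HomogI (Ideal.span s) := by
  have := Ideal.homogeneous_span (homogeneousSubmodule (Fin N) ℂ) s (fun x hx => h x hx)
  intro p hp d
  exact homogeneousComponent_mem_of_mem this hp d

lemma self_of_comp {K : Ideal (MvPolynomial (Fin N) ℂ)} (hK : HomogI K)
    {p g w : MvPolynomial (Fin N) ℂ} {e d : ℕ} (hp : p.IsHomogeneous (e + d))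
    (hg : g.IsHomogeneous e) (h : p - g * w ∈ K) :
    p - g * homogeneousComponent d w ∈ K := by
  have := hK _ h (e + d)
  rwa [map_sub, comp_mul hg, homogeneousComponent_eq_self hp] at this

structure HasSoc (I : Ideal (MvPolynomial (Fin N) ℂ)) (d : ℕ) : Prop where
  vanish : ∀ k p, p.IsHomogeneous k → d < k → p ∈ I
  soc : ∃ δ : MvPolynomial (Fin N) ℂ, δ.IsHomogeneous d ∧ δ ∉ I ∧
    ∀ u, (∀ i, X i * u ∈ I) → ∃ c : ℂ, u - C c * δ ∈ I

lemma mem_idealX {g : MvPolynomial (Fin N) ℂ} {e : ℕ} (he : 1 ≤ e) (hg : g.IsHomogeneous e) :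
    g ∈ Ideal.span (Set.range (X : Fin N → MvPolynomial (Fin N) ℂ)) := by
  rw [← Set.image_univ, mem_ideal_span_X_image]
  intro m hm
  have := hg (mem_support_iff.1 hm)
  by_contra! hc
  have h0 : m = 0 := by ext i; simpa using hc i
  subst h0
  simp at this
  omega

lemma mul_mem_of_X {I : Ideal (MvPolynomial (Fin N) ℂ)} {g u : MvPolynomial (Fin N) ℂ} {e : ℕ}
    (he : 1 ≤ e) (hg : g.IsHomogeneous e) (h : ∀ i, X i * u ∈ I) : g * u ∈ I := by
  have := mem_idealX he hg
  have h2 : Ideal.span (Set.range (X : Fin N → MvPolynomial (Fin N) ℂ)) ≤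
      Submodule.comap (LinearMap.mulRight (MvPolynomial (Fin N) ℂ) u) I := by
    rw [Ideal.span_le]
    rintro _ ⟨i, rfl⟩
    exact h i
  exact h2 this

instance (I : Ideal (MvPolynomial (Fin N) ℂ)) (k : ℕ) : Module.Finite ℂ (gradedPiece I k) := by
  have : Module.Finite ℂ (homogeneousSubmodule (Fin N) ℂ k) :=
    Module.Finite.iff_fg.2 (homogeneousSubmodule_fg _ _ k)
  unfold gradedPiece
  infer_instance

lemma mk_mem {I : Ideal (MvPolynomial (Fin N) ℂ)} {k : ℕ} {p : MvPolynomial (Fin N) ℂ}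
    (hp : p.IsHomogeneous k) : Ideal.Quotient.mk I p ∈ gradedPiece I k := ⟨p, hp, rfl⟩

lemma exists_rep {I : Ideal (MvPolynomial (Fin N) ℂ)} {k : ℕ} (a : gradedPiece I k) :
    ∃ p, ∃ hp : p.IsHomogeneous k, a = ⟨Ideal.Quotient.mk I p, mk_mem hp⟩ := by
  obtain ⟨_, p, hp, rfl⟩ := a
  exact ⟨p, hp, rfl⟩

lemma pairing_eq {I : Ideal (MvPolynomial (Fin N) ℂ)} {k l m : ℕ} (h : k + l = m)
    {p q : MvPolynomial (Fin N) ℂ} (hp : p.IsHomogeneous k) (hq : q.IsHomogeneous l)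
    (hpq : (p * q).IsHomogeneous m) :
    gradedPairing I k l m h ⟨Ideal.Quotient.mk I p, mk_mem hp⟩ ⟨Ideal.Quotient.mk I q, mk_mem hq⟩
      = ⟨Ideal.Quotient.mk I (p * q), mk_mem hpq⟩ := by
  apply Subtype.ext
  simp [gradedPairing]

lemma transfer_vanish {K : Ideal (MvPolynomial (Fin N) ℂ)} (hK : HomogI K)
    {l f : MvPolynomial (Fin N) ℂ} {e d : ℕ}
    (hl : l.IsHomogeneous 1) (hf : f.IsHomogeneous e)
    (hfr : ∀ u, f * u ∈ K → u ∈ K)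
    (h : ∀ k p, p.IsHomogeneous k → d < k → p ∈ K ⊔ Ideal.span {l}) :
    ∀ k p, p.IsHomogeneous k → d + e ≤ k → p ∈ K ⊔ Ideal.span {f} := by
  have A : ∀ j k p, d ≤ k → p.IsHomogeneous (j + k) →
      ∃ q, q.IsHomogeneous k ∧ p - l ^ j * q ∈ K := by
    intro j
    induction j with
    | zero => intro k p _ hp; exact ⟨p, by simpa using hp, by simp⟩
    | succ j ih =>
      intro k p hk hp
      obtain ⟨w, hw⟩ := (mem_sup_iff _ _ _).1 (h _ p hp (by omega))
      have hw' := self_of_comp hK (d := j + k) (by convert hp using 1; ring) hl hw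
      obtain ⟨q, hq, hq2⟩ := ih k _ hk (homogeneousComponent_isHomogeneous (j + k) w)
      refine ⟨q, hq, ?_⟩
      convert K.add_mem hw' (K.mul_mem_left l hq2) using 1
      ring
  intro m p hp hm
  obtain ⟨k, rfl⟩ := Nat.exists_eq_add_of_le (show e ≤ m by omega)
  have hle : (l ^ e).IsHomogeneous e := by simpa using hl.pow e
  let L := gradedPairing K e k (e + k) rfl ⟨_, mk_mem hle⟩
  let F := gradedPairing K e k (e + k) rfl ⟨_, mk_mem hf⟩
  have hL : Function.Surjective L := by
    intro a
    obtain ⟨p, hp, rfl⟩ := exists_rep a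
    obtain ⟨q, hq, hq2⟩ := A e k p (by omega) hp
    refine ⟨⟨_, mk_mem hq⟩, ?_⟩
    rw [pairing_eq rfl hle hq (hle.mul hq)]
    exact Subtype.ext (Ideal.Quotient.eq.2 (by rw [← neg_mem_iff]; simpa using hq2))
  have hF : Function.Injective F := by
    rw [injective_iff_map_eq_zero]
    intro a ha
    obtain ⟨p, hp, rfl⟩ := exists_rep a
    rw [pairing_eq rfl hf hp (hf.mul hp)] at ha
    have := Subtype.ext_iff.1 ha
    exact Subtype.ext (Ideal.Quotient.eq_zero_iff_mem.2
      (hfr _ (Ideal.Quotient.eq_zero_iff_mem.1 this)))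
  have hfin := le_antisymm (LinearMap.finrank_le_finrank_of_injective hF)
    (LinearMap.finrank_le_finrank_of_surjective hL)
  have hFs := (LinearMap.injective_iff_surjective_of_finrank_eq_finrank hfin).1 hF
  obtain ⟨b, hb⟩ := hFs ⟨_, mk_mem hp⟩
  obtain ⟨q, hq, rfl⟩ := exists_rep b
  rw [pairing_eq rfl hf hq (hf.mul hq)] at hb
  have := Ideal.Quotient.eq.1 (Subtype.ext_iff.1 hb)
  refine (mem_sup_iff _ _ _).2 ⟨q, ?_⟩
  rw [← neg_mem_iff]; simpa using this

lemma transfer {K : Ideal (MvPolynomial (Fin N) ℂ)} (hK : HomogI K)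
    {l f : MvPolynomial (Fin N) ℂ} {e d : ℕ} (he : 1 ≤ e)
    (hl : l.IsHomogeneous 1) (hf : f.IsHomogeneous e)
    (hlr : ∀ u, l * u ∈ K → u ∈ K) (hfr : ∀ u, f * u ∈ K → u ∈ K)
    (h : HasSoc (K ⊔ Ideal.span {l}) d) : HasSoc (K ⊔ Ideal.span {f}) (d + (e - 1)) := by
  obtain ⟨hv, δ, hδ, hδI, hsoc⟩ := h
  refine ⟨fun k p hp hk => transfer_vanish hK hl hf hfr hv k p hp (by omega), ?_⟩
  have hx : ∀ i, X i * δ ∈ K ⊔ Ideal.span {l} := fun i =>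
    hv (1 + d) _ ((isHomogeneous_X _ i).mul hδ) (by omega)
  obtain ⟨v, hv0⟩ := (mem_sup_iff _ _ _).1 (mul_mem_of_X he hf hx)
  have hv1 := self_of_comp hK (d := d + (e - 1))
    (by convert hf.mul hδ using 1; omega) hl hv0
  have hvh := homogeneousComponent_isHomogeneous (d + (e - 1)) v
  generalize homogeneousComponent (d + (e - 1)) v = v at hv1 hvh
  refine ⟨v, hvh, ?_, ?_⟩
  · intro hvf
    obtain ⟨w, hw⟩ := (mem_sup_iff _ _ _).1 hvf
    refine hδI ((mem_sup_iff _ _ _).2 ⟨w, hfr _ ?_⟩)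
    convert K.add_mem hv1 (K.mul_mem_left l hw) using 1
    ring
  · intro u hu
    obtain ⟨w, hw⟩ := (mem_sup_iff _ _ _).1 (mul_mem_of_X le_rfl hl hu)
    have hxw : ∀ i, X i * w ∈ K ⊔ Ideal.span {l} := by
      intro i
      obtain ⟨z, hz⟩ := (mem_sup_iff _ _ _).1 (hu i)
      refine (mem_sup_iff _ _ _).2 ⟨z, hfr _ ?_⟩
      convert K.sub_mem (K.mul_mem_left l hz) (K.mul_mem_left (X i) hw) using 1
      ring
    obtain ⟨c, hc⟩ := hsoc w hxw
    obtain ⟨s, hs⟩ := (mem_sup_iff _ _ _).1 hc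
    refine ⟨c, (mem_sup_iff _ _ _).2 ⟨s, hlr _ ?_⟩⟩
    convert K.add_mem (K.add_mem hw (K.mul_mem_left f hs)) (K.mul_mem_left (C c) hv1) using 1
    ring

lemma exists_linear (n : ℕ) (J : ℕ → Ideal (MvPolynomial (Fin N) ℂ))
    (f : ℕ → MvPolynomial (Fin N) ℂ) (e : ℕ → ℕ) (he : ∀ i < n, 1 ≤ e i)
    (hf : ∀ i < n, (f i).IsHomogeneous (e i))
    (hreg : ∀ i < n, ∀ u, f i * u ∈ J i → u ∈ J i) :
    ∃ l : MvPolynomial (Fin N) ℂ, l.IsHomogeneous 1 ∧ ∀ i < n, ∀ u, l * u ∈ J i → u ∈ J i := by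
  classical
  let V := homogeneousSubmodule (Fin N) ℂ 1
  have key : ∀ (i : ℕ) (r : MvPolynomial (Fin N) ℂ),
      (∃ p ∈ associatedPrimes (MvPolynomial (Fin N) ℂ) (MvPolynomial (Fin N) ℂ ⧸ J i), r ∈ p) ↔
        ¬ ∀ u, r * u ∈ J i → u ∈ J i := by
    intro i r
    have := Set.ext_iff.1 (biUnion_associatedPrimes_eq_zero_divisors (MvPolynomial (Fin N) ℂ)
      (MvPolynomial (Fin N) ℂ ⧸ J i)) r
    simp only [Set.mem_iUnion, SetLike.mem_coe, exists_prop, Set.mem_ofPred_eq] at this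
    rw [this]
    push Not
    constructor
    · rintro ⟨x, hx, hx2⟩
      obtain ⟨u, rfl⟩ := Ideal.Quotient.mk_surjective x
      refine ⟨u, ?_, fun h => hx (Ideal.Quotient.eq_zero_iff_mem.2 h)⟩
      exact Ideal.Quotient.eq_zero_iff_mem.1 hx2
    · rintro ⟨u, hu, hu2⟩
      exact ⟨Ideal.Quotient.mk _ u, fun h => hu2 (Ideal.Quotient.eq_zero_iff_mem.1 h),
        Ideal.Quotient.eq_zero_iff_mem.2 hu⟩
  have hfin : (⋃ i ∈ Finset.range n, associatedPrimes (MvPolynomial (Fin N) ℂ)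
      (MvPolynomial (Fin N) ℂ ⧸ J i)).Finite :=
    Set.Finite.biUnion (Finset.finite_toSet _) fun i _ => associatedPrimes.finite _ _
  let s : Finset (Subspace ℂ V) :=
    hfin.toFinset.image fun p => (p.restrictScalars ℂ).comap V.subtype
  have hs : ⊤ ∉ s := by
    intro hs
    simp only [s, Finset.mem_image, Set.Finite.mem_toFinset, Set.mem_iUnion, exists_prop,
      Finset.mem_range] at hs
    obtain ⟨p, ⟨i, hi, hp⟩, htop⟩ := hs
    refine (key i (f i)).1 ⟨p, hp, ?_⟩ (hreg i hi)
    have : Ideal.span (Set.range (X : Fin N → MvPolynomial (Fin N) ℂ)) ≤ p := by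
      rw [Ideal.span_le]
      rintro _ ⟨j, rfl⟩
      have : (⟨X j, isHomogeneous_X _ j⟩ : V) ∈
        (Submodule.comap V.subtype (p.restrictScalars ℂ)) := by rw [htop]; trivial
      exact this
    exact this (mem_idealX (he i hi) (hf i hi))
  have := Subspace.biUnion_ne_univ_of_top_notMem hs
  obtain ⟨v, hv⟩ := (Set.ne_univ_iff_exists_notMem _).1 this
  refine ⟨v, v.2, fun i hi => ?_⟩
  by_contra hc
  obtain ⟨p, hp, hvp⟩ := (key i v).2 hc
  apply hv
  simp only [Set.mem_iUnion]
  refine ⟨(p.restrictScalars ℂ).comap V.subtype, ?_, hvp⟩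
  simp only [s, Finset.mem_image, Set.Finite.mem_toFinset, Set.mem_iUnion, exists_prop,
      Finset.mem_range]
  exact ⟨p, ⟨i, hi, hp⟩, rfl⟩

/-- the intermediate ideals -/
def J (W : Submodule ℂ (MvPolynomial (Fin N) ℂ)) (f : ℕ → MvPolynomial (Fin N) ℂ) (i : ℕ) :
    Ideal (MvPolynomial (Fin N) ℂ) := Ideal.span ((W : Set _) ∪ f '' Set.Iio i)

lemma J_succ (W : Submodule ℂ (MvPolynomial (Fin N) ℂ)) (f : ℕ → MvPolynomial (Fin N) ℂ) (i : ℕ) :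
    J W f (i + 1) = J W f i ⊔ Ideal.span {f i} := by
  unfold J
  rw [← Ideal.span_union, Set.union_assoc]
  congr 2
  ext x
  simp only [Set.mem_image, Set.mem_Iio, Set.mem_union, Set.mem_singleton_iff, Nat.lt_succ_iff_lt_or_eq]
  constructor
  · rintro ⟨j, h | rfl, rfl⟩
    · exact Or.inl ⟨j, h, rfl⟩
    · exact Or.inr rfl
  · rintro (⟨j, h, rfl⟩ | rfl)
    · exact ⟨j, Or.inl h, rfl⟩
    · exact ⟨i, Or.inr rfl, rfl⟩

lemma J_sup (W : Submodule ℂ (MvPolynomial (Fin N) ℂ)) (f : ℕ → MvPolynomial (Fin N) ℂ) (i : ℕ)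
    (l : MvPolynomial (Fin N) ℂ) :
    J (W ⊔ Submodule.span ℂ {l}) f i = J W f i ⊔ Ideal.span {l} := by
  unfold J
  rw [← Ideal.span_union]
  apply le_antisymm
  · rw [Ideal.span_le]
    rintro x (hx | hx)
    · obtain ⟨y, hy, z, hz, rfl⟩ := Submodule.mem_sup.1 hx
      obtain ⟨c, rfl⟩ := Submodule.mem_span_singleton.1 hz
      refine Ideal.add_mem _ (Ideal.subset_span (Or.inl (Or.inl hy))) ?_
      rw [smul_eq_C_mul]
      exact Ideal.mul_mem_left _ _ (Ideal.subset_span (Or.inr rfl))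
    · exact Ideal.subset_span (Or.inl (Or.inr hx))
  · apply Ideal.span_mono
    rintro x ((hx | hx) | rfl)
    · exact Or.inl (Submodule.mem_sup_left hx)
    · exact Or.inr hx
    · exact Or.inl (Submodule.mem_sup_right (Submodule.mem_span_singleton_self x))

lemma homogI_J {W : Submodule ℂ (MvPolynomial (Fin N) ℂ)}
    (hW : W ≤ homogeneousSubmodule (Fin N) ℂ 1) {f : ℕ → MvPolynomial (Fin N) ℂ} {e : ℕ → ℕ}
    {i : ℕ} (hf : ∀ j < i, (f j).IsHomogeneous (e j)) : HomogI (J W f i) := by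
  apply homogI_span
  rintro x (hx | ⟨j, hj, rfl⟩)
  · exact ⟨1, hW hx⟩
  · exact ⟨_, hf j hj⟩

lemma finrank_one_le : Module.finrank ℂ (homogeneousSubmodule (Fin N) ℂ 1) ≤ N := by
  rw [homogeneousSubmodule_one_eq_span_X]
  simpa [Set.finrank] using finrank_range_le_card (R := ℂ) (X : Fin N → MvPolynomial (Fin N) ℂ)

instance (k : ℕ) : Module.Finite ℂ (homogeneousSubmodule (Fin N) ℂ k) :=
    Module.Finite.iff_fg.2 (homogeneousSubmodule_fg _ _ k)

lemma one_notMem : (1 : MvPolynomial (Fin N) ℂ) ∉ Ideal.span (Set.range (X : Fin N → _)) := by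
  rw [← Set.image_univ, mem_ideal_span_X_image]
  push Not
  exact ⟨0, by simp, by simp⟩

lemma main (n : ℕ) : ∀ (W : Submodule ℂ (MvPolynomial (Fin N) ℂ))
    (_ : W ≤ homogeneousSubmodule (Fin N) ℂ 1) (_ : Module.finrank ℂ W + n = N)
    (f : ℕ → MvPolynomial (Fin N) ℂ) (e : ℕ → ℕ) (_ : ∀ i < n, 1 ≤ e i)
    (_ : ∀ i < n, (f i).IsHomogeneous (e i))
    (_ : ∀ i < n, ∀ u, f i * u ∈ J W f i → u ∈ J W f i),
    HasSoc (J W f n) (∑ i ∈ Finset.range n, (e i - 1)) := by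
  induction n with
  | zero =>
    intro W hW hr f e he hf hreg
    have hWe : W = homogeneousSubmodule (Fin N) ℂ 1 :=
      Submodule.eq_of_le_of_finrank_le hW (by have := finrank_one_le (N := N); omega)
    have hJ : J W f 0 = Ideal.span (Set.range X) := by
      unfold J
      apply le_antisymm
      · rw [Ideal.span_le]
        rintro x (hx | ⟨j, hj, rfl⟩)
        · exact mem_idealX le_rfl (hW hx)
        · simp at hj
      · rw [Ideal.span_le]
        rintro _ ⟨i, rfl⟩
        refine Ideal.subset_span (Or.inl ?_)
        rw [hWe]
        exact isHomogeneous_X _ i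
    rw [hJ]
    refine ⟨fun k p hp hk => mem_idealX (by simp at hk; omega) hp, 1, by simpa using isHomogeneous_one _ _,
      one_notMem, fun u _ => ⟨coeff 0 u, ?_⟩⟩
    rw [← Set.image_univ, mem_ideal_span_X_image]
    intro m hm
    by_contra! hc
    have h0 : m = 0 := by ext i; simpa using hc i
    subst h0
    simp at hm
  | succ n ih =>
    intro W hW hr f e he hf hreg
    obtain ⟨l, hl, hlr⟩ := exists_linear (n + 1) (J W f) f e he hf hreg
    have hlW : l ∉ W := by
      intro h
      have h1 : l * 1 ∈ J W f 0 := by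
        rw [mul_one]; exact Ideal.subset_span (Or.inl h)
      have h2 := hlr 0 (by omega) 1 h1
      refine one_notMem ((?_ : J W f 0 ≤ _) h2)
      unfold J
      rw [Ideal.span_le]
      rintro x (hx | ⟨j, hj, rfl⟩)
      · exact mem_idealX le_rfl (hW hx)
      · simp at hj
    have hWfin : FiniteDimensional ℂ W := Submodule.finiteDimensional_of_le hW
    have hrank : Module.finrank ℂ ↥(W ⊔ Submodule.span ℂ {l}) = Module.finrank ℂ W + 1 := by
      have hl0 : l ≠ 0 := fun h => hlW (h ▸ W.zero_mem)
      have h1 := Submodule.finrank_sup_add_finrank_inf_eq W (Submodule.span ℂ {l})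
      have h2 : W ⊓ Submodule.span ℂ {l} = ⊥ :=
        disjoint_iff.1 ((Submodule.disjoint_span_singleton' hl0).2 hlW)
      rw [h2, finrank_bot, finrank_span_singleton hl0] at h1
      omega
    have := ih (W ⊔ Submodule.span ℂ {l}) (sup_le hW (by
        rw [Submodule.span_singleton_le_iff_mem]; exact hl)) (by omega) f e
        (fun i hi => he i (by omega)) (fun i hi => hf i (by omega)) (by
      intro i hi u hu
      rw [J_sup] at hu ⊢
      obtain ⟨w, hw⟩ := (mem_sup_iff _ _ _).1 hu
      have hw1 : w ∈ J W f (i + 1) := by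
        apply hlr (i + 1) (by omega)
        rw [J_succ, mem_sup_iff]
        refine ⟨u, ?_⟩
        rw [← neg_mem_iff]; simpa using hw
      rw [J_succ, mem_sup_iff] at hw1
      obtain ⟨z, hz⟩ := hw1
      rw [mem_sup_iff]
      refine ⟨z, hreg i (by omega) _ ?_⟩
      convert Ideal.add_mem _ hw (Ideal.mul_mem_left _ l hz) using 1
      ring)
    rw [J_sup] at this
    rw [J_succ, Finset.sum_range_succ]
    exact transfer (homogI_J hW (e := e) fun j hj => hf j (by omega)) (he n (by omega)) hl
      (hf n (by omega)) (hlr n (by omega)) (hreg n (by omega)) this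

lemma exists_mul {I : Ideal (MvPolynomial (Fin N) ℂ)} (hI : HomogI I) {d : ℕ} (h : HasSoc I d)
    (j : ℕ) : ∀ k p, p.IsHomogeneous k → k + j = d → p ∉ I →
      ∃ q, q.IsHomogeneous j ∧ p * q ∉ I := by
  induction j with
  | zero => intro k p hp _ hpI; exact ⟨1, isHomogeneous_one _ _, by simpa using hpI⟩
  | succ j ih =>
    intro k p hp hk hpI
    obtain ⟨hv, δ, hδ, hδI, hsoc⟩ := h
    by_cases hx : ∀ i, X i * p ∈ I
    · exfalso
      obtain ⟨c, hc⟩ := hsoc p hx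
      have := hI _ hc k
      rw [map_sub, homogeneousComponent_C_mul, homogeneousComponent_eq_self hp,
        homogeneousComponent_of_mem hδ, if_neg (by omega)] at this
      apply hpI
      simpa using this
    · push Not at hx
      obtain ⟨i, hi⟩ := hx
      obtain ⟨q, hq, hq2⟩ := ih (1 + k) (X i * p) ((isHomogeneous_X _ i).mul hp) (by omega) hi
      refine ⟨q * X i, hq.mul (isHomogeneous_X _ i), ?_⟩
      convert hq2 using 1
      ring

lemma pairing_inj {I : Ideal (MvPolynomial (Fin N) ℂ)} (hI : HomogI I) {d : ℕ} (h : HasSoc I d)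
    (k j : ℕ) (hkj : k + j = d) : Function.Injective (gradedPairing I k j d hkj) := by
  rw [injective_iff_map_eq_zero]
  intro a ha
  obtain ⟨p, hp, rfl⟩ := exists_rep a
  by_contra hne
  have hpI : p ∉ I := fun hh => hne (Subtype.ext (Ideal.Quotient.eq_zero_iff_mem.2 hh))
  obtain ⟨q, hq, hpq⟩ := exists_mul hI h j k p hp hkj hpI
  apply hpq
  have h1 := LinearMap.congr_fun ha ⟨_, mk_mem hq⟩
  rw [pairing_eq hkj hp hq (hkj ▸ hp.mul hq)] at h1
  exact Ideal.Quotient.eq_zero_iff_mem.1 (Subtype.ext_iff.1 h1)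

lemma finrank_top {I : Ideal (MvPolynomial (Fin N) ℂ)} {d : ℕ} (h : HasSoc I d) :
    Module.finrank ℂ (gradedPiece I d) = 1 := by
  obtain ⟨hv, δ, hδ, hδI, hsoc⟩ := h
  refine finrank_eq_one ⟨_, mk_mem hδ⟩ (fun h0 => hδI ?_) ?_
  · exact Ideal.Quotient.eq_zero_iff_mem.1 (Subtype.ext_iff.1 h0)
  · intro a
    obtain ⟨p, hp, rfl⟩ := exists_rep a
    obtain ⟨c, hc⟩ := hsoc p fun i => hv (1 + d) _ ((isHomogeneous_X _ i).mul hp) (by omega)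
    refine ⟨c, Subtype.ext ?_⟩
    rw [← smul_eq_C_mul] at hc
    exact (Ideal.Quotient.eq.2 hc).symm

lemma bij_of_inj {A B T : Type*} [AddCommGroup A] [Module ℂ A] [AddCommGroup B] [Module ℂ B]
    [AddCommGroup T] [Module ℂ T] [Module.Finite ℂ A] [Module.Finite ℂ B] [Module.Finite ℂ T]
    (hT : Module.finrank ℂ T = 1) (φ : A →ₗ[ℂ] B →ₗ[ℂ] T) (ψ : B →ₗ[ℂ] A →ₗ[ℂ] T)
    (h1 : Function.Injective φ) (h2 : Function.Injective ψ) : Function.Bijective φ := by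
  have e1 := LinearMap.finrank_le_finrank_of_injective h1
  have e2 := LinearMap.finrank_le_finrank_of_injective h2
  rw [Module.finrank_linearMap, hT, mul_one] at e1 e2
  refine ⟨h1, (LinearMap.injective_iff_surjective_of_finrank_eq_finrank ?_).1 h1⟩
  rw [Module.finrank_linearMap, hT, mul_one]
  omega

lemma pairing_bij {I : Ideal (MvPolynomial (Fin N) ℂ)} (hI : HomogI I) {d : ℕ} (h : HasSoc I d)
    (k j : ℕ) (hkj : k + j = d) : Function.Bijective (gradedPairing I k j d hkj) :=
  bij_of_inj (A := gradedPiece I k) (B := gradedPiece I j) (T := gradedPiece I d) (finrank_top h)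
    (gradedPairing I k j d hkj) (gradedPairing I j k d (by omega))
    (pairing_inj hI h k j hkj) (pairing_inj hI h j k (by omega))

end GorAux

/-- Gorenstein duality for Artinian complete intersections: for `0 ≤ k ≤ σ`, the multiplication
pairing `R_k × R_{σ-k} → R_σ` is perfect, i.e. `a ↦ (b ↦ a·b)` is bijective onto
`Hom_ℂ(R_{σ-k}, R_σ)`. -/
theorem gorenstein_duality_perfect_pairing
    (N : ℕ) (hN : 1 ≤ N) (f : Fin N → MvPolynomial (Fin N) ℂ) (e : Fin N → ℕ)
    (he : ∀ i, 1 ≤ e i) (hf : ∀ i, (f i).IsHomogeneous (e i))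
    (hreg : RingTheory.Sequence.IsRegular (MvPolynomial (Fin N) ℂ) (List.ofFn f))
    (k : ℕ) (hk : k ≤ ∑ i : Fin N, (e i - 1)) :
    Function.Bijective
      (gradedPairing (Ideal.span (Set.range f)) k ((∑ i : Fin N, (e i - 1)) - k)
        (∑ i : Fin N, (e i - 1)) (by omega)) := by
  let F : ℕ → MvPolynomial (Fin N) ℂ := fun i => if h : i < N then f ⟨i, h⟩ else 0
  let E : ℕ → ℕ := fun i => if h : i < N then e ⟨i, h⟩ else 0
  have hFi : ∀ i (h : i < N), F i = f ⟨i, h⟩ := fun i h => by simp [F, h]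
  have hEi : ∀ i (h : i < N), E i = e ⟨i, h⟩ := fun i h => by simp [E, h]
  have hJ : ∀ i ≤ N, GorAux.J ⊥ F i = Ideal.ofList ((List.ofFn f).take i) := by
    intro i hi
    unfold GorAux.J Ideal.ofList
    apply le_antisymm
    · rw [Ideal.span_le]
      rintro x (hx | ⟨j, hj, rfl⟩)
      · rw [show x = 0 by simpa using hx]; exact Ideal.zero_mem _
      · have hj' : j < i := hj
        refine Ideal.subset_span ?_
        rw [Set.mem_ofPred_eq, hFi j (by omega), List.mem_take_iff_getElem]
        exact ⟨j, by simp; omega, by simp⟩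
    · rw [Ideal.span_le]
      intro x hx
      rw [Set.mem_ofPred_eq, List.mem_take_iff_getElem] at hx
      obtain ⟨j, hj, rfl⟩ := hx
      simp at hj
      refine Ideal.subset_span (Or.inr ⟨j, hj.1, ?_⟩)
      rw [hFi j (by omega)]; simp
  have hJN : GorAux.J ⊥ F N = Ideal.span (Set.range f) := by
    rw [hJ N le_rfl, List.take_of_length_le (by simp)]
    unfold Ideal.ofList
    congr 1
    ext x
    simp [List.mem_ofFn]
  have hsum : ∑ i : Fin N, (e i - 1) = ∑ i ∈ Finset.range N, (E i - 1) := by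
    rw [Finset.sum_range]
    exact Finset.sum_congr rfl fun i _ => by rw [hEi i i.2]
  have hFh : ∀ i < N, (F i).IsHomogeneous (E i) := fun i hi => by
    rw [hFi i hi, hEi i hi]; exact hf _
  have hs := GorAux.main (N := N) N ⊥ bot_le (by simp) F E
    (fun i hi => by rw [hEi i hi]; exact he _) hFh (by
      intro i hi u hu
      have hw := (RingTheory.Sequence.isWeaklyRegular_iff_Fin _ _).1 hreg.1 ⟨i, by simpa using hi⟩
      rw [hJ i hi.le] at hu ⊢
      rw [isSMulRegular_iff_right_eq_zero_of_smul] at hw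
      have h3 := hw (Submodule.Quotient.mk u) (by
        rw [← Submodule.Quotient.mk_smul, Submodule.Quotient.mk_eq_zero]
        simpa [hFi i hi] using hu)
      rw [Submodule.Quotient.mk_eq_zero] at h3
      simpa using h3)
  have hh := GorAux.homogI_J (W := ⊥) bot_le hFh
  rw [hJN] at hs hh
  rw [← hsum] at hs
  exact GorAux.pairing_bij hh hs _ _ _
end
end

section
/- Let e ≥ 2 and m ≥ 2 be integers and for 0 ≤ k ≤ m(e−1) let c_k denote the coefficient of t^k in the polynomial (1 + t + ⋯ + t^{e−1})^m ∈ ℤ[t]. Then the coefficients are symmetric, c_k = c_{m(e−1)−k} for all 0 ≤ k ≤ m(e−1), and strictly increasing up to the middle: c_k < c_{k+1} whenever 2(k+1) ≤ m(e−1). -/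
/-- Coefficients extended to the integers. -/
def cf (d : ℕ) : ℕ → ℤ → ℤ
  | 0, k => if k = 0 then 1 else 0
  | m + 1, k => ∑ i ∈ Finset.range (d + 1), cf d m (k - i)

lemma cf_neg (d m : ℕ) : ∀ k : ℤ, k < 0 → cf d m k = 0 := by
  induction m with
  | zero => intro k hk; simp [cf, hk.ne]
  | succ m ih =>
    intro k hk
    rw [cf]
    exact Finset.sum_eq_zero fun i _ => ih _ (by omega)

lemma cf_symm (d m : ℕ) : ∀ k : ℤ, cf d m (m * d - k) = cf d m k := by
  induction m with
  | zero => intro k; simp [cf]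
  | succ m ih =>
    intro k
    rw [cf, cf, ← Finset.sum_range_reflect]
    refine Finset.sum_congr rfl fun i hi => ?_
    rw [← ih (k - i)]
    congr 1
    have : i ≤ d := by simpa [Nat.lt_succ_iff] using hi
    have h2 : d + 1 - 1 - i = d - i := by omega
    rw [h2]
    push_cast [this]
    ring

lemma cf_step (d m : ℕ) (k : ℤ) :
    cf d (m + 1) (k + 1) - cf d (m + 1) k = cf d m (k + 1) - cf d m (k - d) := by
  rw [cf, cf, Finset.sum_range_succ', Finset.sum_range_succ]
  have : ∀ i : ℕ, k + 1 - ((i + 1 : ℕ) : ℤ) = k - i := by intro i; push_cast; ring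
  simp only [this]
  simp

lemma cf_one (d : ℕ) (k : ℤ) (h0 : 0 ≤ k) (h1 : k ≤ d) : cf d 1 k = 1 := by
  rw [cf, Finset.sum_eq_single k.toNat]
  · simp [cf, h0]
  · intro b _ hb
    have : k - b ≠ 0 := by omega
    simp [cf, this]
  · intro h
    simp at h
    omega

lemma cf_closer (d m : ℕ)
    (hs : ∀ k : ℤ, -1 ≤ k → 2 * (k + 1) ≤ m * d → cf d m k < cf d m (k + 1))
    (i j : ℤ) (hij : i < j) (h : i + j < m * d) (h0 : 0 ≤ j) (h1 : j ≤ m * d) :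
    cf d m i < cf d m j := by
  have mono : ∀ i j : ℤ, i ≤ j → 2 * j ≤ m * d → cf d m i ≤ cf d m j := by
    intro i j hij
    induction j, hij using Int.le_induction with
    | base => intro _; exact le_rfl
    | succ n hn ih =>
      intro h
      refine (ih (by linarith)).trans ?_
      by_cases hc : -1 ≤ n
      · exact (hs n hc h).le
      · rw [cf_neg d m n (by omega), cf_neg d m (n + 1) (by omega)]
  have st : ∀ j : ℤ, i < j → 0 ≤ j → 2 * j ≤ m * d → cf d m i < cf d m j := by
    intro j hij h0 h2
    have a := mono i (j - 1) (by omega) (by linarith)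
    have b := hs (j - 1) (by omega) (by linarith)
    rw [sub_add_cancel] at b
    exact a.trans_lt b
  by_cases hc : 2 * j ≤ m * d
  · exact st j hij h0 hc
  · rw [← cf_symm d m j]
    exact st _ (by linarith) (by linarith) (by linarith)

lemma cf_strict (d m : ℕ) (k : ℤ) (hk : -1 ≤ k) (h : 2 * (k + 1) ≤ (m + 2 : ℕ) * d) :
    cf d (m + 2) k < cf d (m + 2) (k + 1) := by
  induction m generalizing k with
  | zero =>
    have := cf_step d 1 k
    push_cast at h
    rw [cf_one d (k + 1) (by omega) (by omega), cf_neg d 1 (k - d) (by omega)] at this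
    simp only [Nat.zero_add]
    change _ = _ at this
    norm_num at this ⊢
    linarith
  | succ m ih =>
    have := cf_step d (m + 2) k
    have hmd : (0 : ℤ) ≤ m * d := by positivity
    have := cf_closer d (m + 2) ih (k - d) (k + 1) (by omega)
      (by push_cast at h ⊢; linarith) (by omega) (by push_cast at h ⊢; nlinarith)
    rw [show m + 1 + 2 = m + 2 + 1 by ring]
    linarith

lemma coeff_cf (d m : ℕ) (k : ℕ) :
    ((∑ i ∈ Finset.range (d + 1), (Polynomial.X : Polynomial ℤ) ^ i) ^ m).coeff k = cf d m k := by
  induction m generalizing k with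
  | zero => simp [cf, Polynomial.coeff_one]
  | succ m ih =>
    rw [pow_succ, Finset.mul_sum, Polynomial.finset_sum_coeff, cf]
    refine Finset.sum_congr rfl fun i _ => ?_
    rw [Polynomial.coeff_mul_X_pow']
    split_ifs with h
    · rw [ih]; push_cast [h]; rfl
    · rw [cf_neg]; omega

/-- The coefficients of `(1 + t + ⋯ + t^{e-1})^m ∈ ℤ[t]` (for `e, m ≥ 2`) are symmetric about
`m(e-1)/2` and strictly increasing up to the middle. -/
theorem coeff_pow_geom_symmetric_and_strictly_increasing
    (e m : ℕ) (he : 2 ≤ e) (hm : 2 ≤ m) :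
    (∀ k : ℕ, k ≤ m * (e - 1) →
      ((∑ i ∈ Finset.range e, (Polynomial.X : Polynomial ℤ) ^ i) ^ m).coeff k
        = ((∑ i ∈ Finset.range e, (Polynomial.X : Polynomial ℤ) ^ i) ^ m).coeff (m * (e - 1) - k)) ∧
    (∀ k : ℕ, 2 * (k + 1) ≤ m * (e - 1) →
      ((∑ i ∈ Finset.range e, (Polynomial.X : Polynomial ℤ) ^ i) ^ m).coeff k
        < ((∑ i ∈ Finset.range e, (Polynomial.X : Polynomial ℤ) ^ i) ^ m).coeff (k + 1)) := by
  obtain ⟨d, rfl⟩ : ∃ d, e = d + 1 := ⟨e - 1, by omega⟩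
  obtain ⟨n, rfl⟩ : ∃ n, m = n + 2 := ⟨m - 2, by omega⟩
  simp only [Nat.add_sub_cancel]
  constructor
  · intro k hk
    rw [coeff_cf, coeff_cf, ← cf_symm, Nat.cast_sub hk, Nat.cast_mul]
  · intro k hk
    rw [coeff_cf, coeff_cf, Nat.cast_succ]
    exact cf_strict d n k (by omega) (by exact_mod_cast hk)
end
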